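/- arXiv:1702.08136 — 11 statements merged into one kernel-verified Lean document; each statement's English description precedes it below -/
import Mathlib

section
/- Let V be a set and let C : V → V and R : V → V be maps satisfying C(C(P)) = P and R(R(P)) = P for all P ∈ V. Let P ∈ V satisfy C(P) = P, and suppose m ≥ 2 is the least positive integer with (R∘C)^m(P) = P. Then the number of indices h ∈ {0, 1, …, m−1} for which (R∘C)^h(P) is a fixed point of C, plus the number of indices h ∈ {0, 1, …, m−1} for which (R∘C)^h(P) is a fixed point of R, equals 2. More precisely, if m is odd the only C-fixed point in the list is at h = 0 and the only R-fixed point is at h = (m+1)/2, while if m is even the only C-fixed points are at h = 0 and h = m/2 and there are no R-fixed points in the list. -/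
namespace Function.Involutive

variable {V : Type*} {C R : V → V}

theorem injective_comp (hC : Involutive C) (hR : Involutive R) : Injective (R ∘ C) :=
  hR.injective.comp hC.injective

theorem iterate_comp_apply (hC : Involutive C) (hR : Involutive R) (h : ℕ) (x : V) :
    (R ∘ C)^[h] (C ((R ∘ C)^[h] x)) = C x := by
  induction h generalizing x with
  | zero => rfl
  | succ k ih =>
    rw [iterate_succ_apply (R ∘ C) k x, iterate_succ_apply', ih]
    simp [hC _, hR _]

theorem left_fixed_iterate_iff (hC : Involutive C) (hR : Involutive R) {P : V} (hP : C P = P)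
    (h : ℕ) : C ((R ∘ C)^[h] P) = (R ∘ C)^[h] P ↔ (R ∘ C)^[0] P = (R ∘ C)^[2 * h] P := by
  rw [← ((hC.injective_comp hR).iterate h).eq_iff, hC.iterate_comp_apply hR, hP,
    ← iterate_add_apply, two_mul, iterate_zero_apply]

theorem right_fixed_iterate_iff (hC : Involutive C) (hR : Involutive R) {P : V} (hP : C P = P)
    (h : ℕ) : R ((R ∘ C)^[h] P) = (R ∘ C)^[h] P ↔ (R ∘ C)^[1] P = (R ∘ C)^[2 * h] P := by
  have key : R ((R ∘ C)^[h] P) = (R ∘ C) (C ((R ∘ C)^[h] P)) := by simp [hC _]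
  rw [key, ← ((hC.injective_comp hR).iterate h).eq_iff, ← iterate_succ_apply,
    iterate_succ_apply', hC.iterate_comp_apply hR, hP, ← iterate_add_apply, two_mul,
    iterate_one]

end Function.Involutive

theorem Function.iterate_eq_iterate_iff_of_lt_two_mul {V : Type*} {f : V → V}
    (hf : Function.Injective f) {P : V} {m : ℕ} (hmP : f^[m] P = P)
    (hleast : ∀ k, 0 < k → k < m → f^[k] P ≠ P) {a b : ℕ} (ha : a < m) (hb : b < 2 * m) :
    f^[a] P = f^[b] P ↔ b = a ∨ b = a + m := by
  have hinj : ∀ {i j : ℕ}, i < j → j < m → f^[i] P ≠ f^[j] P := by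
    intro i j hij hj heq
    refine hleast (j - i) (by omega) (by omega) (hf.iterate i ?_)
    rw [← iterate_add_apply, Nat.add_sub_cancel' hij.le, heq]
  have hinj' : ∀ {i j : ℕ}, i < m → j < m → f^[i] P = f^[j] P → i = j := by
    intro i j hi hj heq
    rcases lt_trichotomy i j with h | h | h
    · exact absurd heq (hinj h hj)
    · exact h
    · exact absurd heq.symm (hinj h hi)
  have hshift (k : ℕ) : f^[k + m] P = f^[k] P := by rw [iterate_add_apply, hmP]
  constructor
  · intro heq
    by_cases hbm : b < m
    · exact Or.inl (hinj' ha hbm heq).symm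
    · have hb' : b = (b - m) + m := by omega
      rw [hb', hshift] at heq
      have := hinj' ha (by omega) heq
      omega
  · rintro (rfl | rfl)
    · rfl
    · exact (hshift a).symm


/-- Inside Lemma 1: counting self-conjugate (`C`-fixed) and invariant (`R`-fixed)
points in the orbit of a self-conjugate point `P` of finite order `m ≥ 2` under
the `R ∘ C` operation. -/
theorem stmt_1 {V : Type*} (C R : V → V)
    (hC : ∀ P, C (C P) = P) (hR : ∀ P, R (R P) = P)
    (P : V) (hP : C P = P) (m : ℕ) (hm : 2 ≤ m)
    (hmP : (R ∘ C)^[m] P = P)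
    (hleast : ∀ k, 0 < k → k < m → (R ∘ C)^[k] P ≠ P) :
    ({h : ℕ | h < m ∧ C ((R ∘ C)^[h] P) = (R ∘ C)^[h] P}.ncard
      + {h : ℕ | h < m ∧ R ((R ∘ C)^[h] P) = (R ∘ C)^[h] P}.ncard = 2)
    ∧ (Odd m →
        {h : ℕ | h < m ∧ C ((R ∘ C)^[h] P) = (R ∘ C)^[h] P} = {0}
        ∧ {h : ℕ | h < m ∧ R ((R ∘ C)^[h] P) = (R ∘ C)^[h] P} = {(m + 1) / 2})
    ∧ (Even m →
        {h : ℕ | h < m ∧ C ((R ∘ C)^[h] P) = (R ∘ C)^[h] P} = {0, m / 2}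
        ∧ {h : ℕ | h < m ∧ R ((R ∘ C)^[h] P) = (R ∘ C)^[h] P} = ∅) := by
  have hinj := Function.Involutive.injective_comp hC hR
  have hCiff : ∀ h, h < m → (C ((R ∘ C)^[h] P) = (R ∘ C)^[h] P ↔ 2 * h = 0 ∨ 2 * h = 0 + m) :=
    fun h hh => (Function.Involutive.left_fixed_iterate_iff hC hR hP h).trans
      (Function.iterate_eq_iterate_iff_of_lt_two_mul hinj hmP hleast (by omega) (by omega))
  have hRiff : ∀ h, h < m → (R ((R ∘ C)^[h] P) = (R ∘ C)^[h] P ↔ 2 * h = 1 ∨ 2 * h = 1 + m) :=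
    fun h hh => (Function.Involutive.right_fixed_iterate_iff hC hR hP h).trans
      (Function.iterate_eq_iterate_iff_of_lt_two_mul hinj hmP hleast (by omega) (by omega))
  have hCset : {h : ℕ | h < m ∧ C ((R ∘ C)^[h] P) = (R ∘ C)^[h] P} =
      {h : ℕ | h < m ∧ (2 * h = 0 ∨ 2 * h = 0 + m)} :=
    Set.ext fun h => and_congr_right (hCiff h)
  have hRset : {h : ℕ | h < m ∧ R ((R ∘ C)^[h] P) = (R ∘ C)^[h] P} =
      {h : ℕ | h < m ∧ (2 * h = 1 ∨ 2 * h = 1 + m)} :=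
    Set.ext fun h => and_congr_right (hRiff h)
  rw [hCset, hRset]
  have hodd : Odd m → {h : ℕ | h < m ∧ (2 * h = 0 ∨ 2 * h = 0 + m)} = {0} ∧
      {h : ℕ | h < m ∧ (2 * h = 1 ∨ 2 * h = 1 + m)} = {(m + 1) / 2} := by
    rintro ⟨k, rfl⟩
    constructor <;> ext h <;> simp only [Set.mem_ofPred_eq, Set.mem_singleton_iff] <;> omega
  have heven : Even m → {h : ℕ | h < m ∧ (2 * h = 0 ∨ 2 * h = 0 + m)} = {0, m / 2} ∧
      {h : ℕ | h < m ∧ (2 * h = 1 ∨ 2 * h = 1 + m)} = ∅ := by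
    rintro ⟨k, rfl⟩
    constructor <;> ext h <;>
      simp only [Set.mem_ofPred_eq, Set.mem_insert_iff, Set.mem_singleton_iff,
        Set.mem_empty_iff_false, iff_false] <;> omega
  refine ⟨?_, hodd, heven⟩
  rcases Nat.even_or_odd m with h | h
  · rw [(heven h).1, (heven h).2, Set.ncard_pair (by omega), Set.ncard_empty]
  · rw [(hodd h).1, (hodd h).2, Set.ncard_singleton, Set.ncard_singleton]
end

section
/- Let V be a set and let C : V → V and R : V → V be maps satisfying C(C(P)) = P and R(R(P)) = P for all P ∈ V. Let P ∈ V satisfy R(P) = P, and suppose m ≥ 2 is the least positive integer with (R∘C)^m(P) = P. Then the number of indices h ∈ {0, 1, …, m−1} for which (R∘C)^h(P) is a fixed point of C, plus the number of indices h ∈ {0, 1, …, m−1} for which (R∘C)^h(P) is a fixed point of R, equals 2. More precisely, if m is odd the only C-fixed point in the list is at h = (m−1)/2 and the only R-fixed point is at h = 0, while if m is even there are no C-fixed points in the list and the only R-fixed points are at h = 0 and h = m/2. -/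
section InvolutionOrbits

variable {V : Type*} {C R : V → V}

theorem iterate_comp_apply_iterate_comp (hC : Function.Involutive C) (hR : Function.Involutive R)
    (n : ℕ) (x : V) : (R ∘ C)^[n] (R ((R ∘ C)^[n] x)) = R x := by
  induction n generalizing x with
  | zero => rfl
  | succ n ih =>
    rw [Function.iterate_succ_apply' (R ∘ C) n (R _), Function.iterate_succ_apply, ih]
    simp [hR _, hC _]

/-- On the orbit of an `R`-fixed point, being fixed by `R` is a periodicity condition. -/
theorem apply_iterate_comp_eq_iff_right (hC : Function.Involutive C)
    (hR : Function.Involutive R) {x : V} (hx : R x = x) (n : ℕ) :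
    R ((R ∘ C)^[n] x) = (R ∘ C)^[n] x ↔ (R ∘ C).IsPeriodicPt (2 * n) x := by
  have key := iterate_comp_apply_iterate_comp hC hR n x
  rw [hx] at key
  rw [Function.IsPeriodicPt, Function.IsFixedPt, two_mul, Function.iterate_add_apply,
    ← ((hR.injective.comp hC.injective).iterate n).eq_iff, key, eq_comm]

/-- On the orbit of an `R`-fixed point, being fixed by `C` is a periodicity condition. -/
theorem apply_iterate_comp_eq_iff_left (hC : Function.Involutive C)
    (hR : Function.Involutive R) {x : V} (hx : R x = x) (n : ℕ) :
    C ((R ∘ C)^[n] x) = (R ∘ C)^[n] x ↔ (R ∘ C).IsPeriodicPt (2 * n + 1) x := by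
  have key := iterate_comp_apply_iterate_comp hC hR (n + 1) x
  rw [hx, Function.iterate_succ_apply' _ n x, Function.comp_apply (f := R), hR] at key
  rw [Function.IsPeriodicPt, Function.IsFixedPt, show 2 * n + 1 = (n + 1) + n by ring,
    Function.iterate_add_apply,
    ← ((hR.injective.comp hC.injective).iterate (n + 1)).eq_iff, key, eq_comm]

end InvolutionOrbits


/-- Inside Lemma 1: counting self-conjugate (`C`-fixed) and invariant (`R`-fixed)
points in the orbit of an invariant point `P` of finite order `m ≥ 2` under
the `R ∘ C` operation. -/
theorem stmt_2 {V : Type*} (C R : V → V)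
    (hC : ∀ P, C (C P) = P) (hR : ∀ P, R (R P) = P)
    (P : V) (hP : R P = P) (m : ℕ) (hm : 2 ≤ m)
    (hmP : (R ∘ C)^[m] P = P)
    (hleast : ∀ k, 0 < k → k < m → (R ∘ C)^[k] P ≠ P) :
    ({h : ℕ | h < m ∧ C ((R ∘ C)^[h] P) = (R ∘ C)^[h] P}.ncard
      + {h : ℕ | h < m ∧ R ((R ∘ C)^[h] P) = (R ∘ C)^[h] P}.ncard = 2)
    ∧ (Odd m →
        {h : ℕ | h < m ∧ C ((R ∘ C)^[h] P) = (R ∘ C)^[h] P} = {(m - 1) / 2}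
        ∧ {h : ℕ | h < m ∧ R ((R ∘ C)^[h] P) = (R ∘ C)^[h] P} = {0})
    ∧ (Even m →
        {h : ℕ | h < m ∧ C ((R ∘ C)^[h] P) = (R ∘ C)^[h] P} = ∅
        ∧ {h : ℕ | h < m ∧ R ((R ∘ C)^[h] P) = (R ∘ C)^[h] P} = {0, m / 2}) := by
  have hper : (R ∘ C).minimalPeriod P = m := by
    have hpt : (R ∘ C).IsPeriodicPt m P := hmP
    refine le_antisymm (hpt.minimalPeriod_le (by lia)) (not_lt.1 fun hlt => ?_)
    exact hleast _ (hpt.minimalPeriod_pos (by lia)) hlt Function.iterate_minimalPeriod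
  simp only [apply_iterate_comp_eq_iff_left hC hR hP, apply_iterate_comp_eq_iff_right hC hR hP,
    Function.isPeriodicPt_iff_minimalPeriod_dvd, hper]
  have dvd_iff : ∀ n, n < 2 * m → (m ∣ n ↔ n = 0 ∨ n = m) := by
    refine fun n hn => ⟨?_, by rintro (rfl | rfl) <;> simp⟩
    rintro ⟨k, rfl⟩
    have hk : k < 2 := by nlinarith
    interval_cases k <;> simp
  have hR_set : {h : ℕ | h < m ∧ m ∣ 2 * h} = {h : ℕ | h = 0 ∨ 2 * h = m} := by
    ext h
    have := dvd_iff (2 * h)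
    simp only [Set.mem_ofPred_eq]
    lia
  have hC_set : {h : ℕ | h < m ∧ m ∣ 2 * h + 1} = {h : ℕ | 2 * h + 1 = m} := by
    ext h
    have := dvd_iff (2 * h + 1)
    simp only [Set.mem_ofPred_eq]
    lia
  rw [hR_set, hC_set]
  have hodd : Odd m → {h : ℕ | 2 * h + 1 = m} = {(m - 1) / 2} ∧
      {h : ℕ | h = 0 ∨ 2 * h = m} = {0} := by
    rintro ⟨k, rfl⟩
    constructor <;> ext h <;> simp <;> lia
  have heven : Even m → {h : ℕ | 2 * h + 1 = m} = ∅ ∧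
      {h : ℕ | h = 0 ∨ 2 * h = m} = {0, m / 2} := by
    rintro ⟨k, rfl⟩
    constructor <;> ext h <;> simp <;> lia
  refine ⟨?_, hodd, heven⟩
  rcases Nat.even_or_odd m with hpar | hpar
  · rw [(heven hpar).1, (heven hpar).2, Set.ncard_empty, Set.ncard_pair (by lia)]
  · rw [(hodd hpar).1, (hodd hpar).2, Set.ncard_singleton, Set.ncard_singleton]
end

section
/- Let a and b be rational numbers with a ≠ b and a ≠ −b. Define Q(x₁,x₂) = (a−b)²x₁² + 2(a−b)²x₁x₂ + 4(a²+ab+b²)x₂², C₄(x₁,x₂) = x₁³ − (12(a²+ab+b²)/(a−b)²)·x₁x₂² − (8(a²+ab+b²)/(a−b)²)·x₂³, and C₅(x₁,x₂) = x₁²x₂ + 2x₁x₂² − (4ab/(a−b)²)·x₂³. Then for all rational x₁, x₂, each of Q, C₄ and C₅ is unchanged when x₁ is replaced by −a·x₁/(a+b) − 2(a²+ab+b²)·x₂/(a²−b²) and x₂ is replaced by (a−b)·x₁/(2(a+b)) − b·x₂/(a+b); that is, Q(x₁',x₂') = Q(x₁,x₂), C₄(x₁',x₂') = C₄(x₁,x₂)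 and C₅(x₁',x₂') = C₅(x₁,x₂), where x₁', x₂' denote the substituted values. -/
/-- The quadratic form `Q` of Lemma 2. -/
def stmt3Q (a b x₁ x₂ : ℚ) : ℚ :=
  (a - b) ^ 2 * x₁ ^ 2 + 2 * (a - b) ^ 2 * x₁ * x₂ + 4 * (a ^ 2 + a * b + b ^ 2) * x₂ ^ 2

/-- The cubic form `C₄` of Lemma 2. -/
def stmt3C4 (a b x₁ x₂ : ℚ) : ℚ :=
  x₁ ^ 3 - 12 * (a ^ 2 + a * b + b ^ 2) / (a - b) ^ 2 * x₁ * x₂ ^ 2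
    - 8 * (a ^ 2 + a * b + b ^ 2) / (a - b) ^ 2 * x₂ ^ 3

/-- The cubic form `C₅` of Lemma 2. -/
def stmt3C5 (a b x₁ x₂ : ℚ) : ℚ :=
  x₁ ^ 2 * x₂ + 2 * x₁ * x₂ ^ 2 - 4 * a * b / (a - b) ^ 2 * x₂ ^ 3

/-- Lemma 2 of the paper: the forms `Q`, `C₄`, `C₅` are invariant under the
given fractional-linear substitution. -/
theorem stmt_3 (a b : ℚ) (hab : a ≠ b) (hab' : a ≠ -b) (x₁ x₂ : ℚ) :
    stmt3Q a b (-a * x₁ / (a + b) - 2 * (a ^ 2 + a * b + b ^ 2) * x₂ / (a ^ 2 - b ^ 2))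
        ((a - b) * x₁ / (2 * (a + b)) - b * x₂ / (a + b)) = stmt3Q a b x₁ x₂
    ∧ stmt3C4 a b (-a * x₁ / (a + b) - 2 * (a ^ 2 + a * b + b ^ 2) * x₂ / (a ^ 2 - b ^ 2))
        ((a - b) * x₁ / (2 * (a + b)) - b * x₂ / (a + b)) = stmt3C4 a b x₁ x₂
    ∧ stmt3C5 a b (-a * x₁ / (a + b) - 2 * (a ^ 2 + a * b + b ^ 2) * x₂ / (a ^ 2 - b ^ 2))
        ((a - b) * x₁ / (2 * (a + b)) - b * x₂ / (a + b)) = stmt3C5 a b x₁ x₂ := by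
  have h₁ : a - b ≠ 0 := sub_ne_zero.mpr hab
  have h₂ : a + b ≠ 0 := fun h => hab' (eq_neg_of_add_eq_zero_left h)
  have h₃ : a ^ 2 - b ^ 2 = (a - b) * (a + b) := by ring
  rw [h₃]
  refine ⟨?_, ?_, ?_⟩
  · unfold stmt3Q
    field_simp
    ring
  · unfold stmt3C4
    field_simp
    ring
  · unfold stmt3C5
    field_simp
    ring
end

section
/- Let p, q, m₁, m₂, x₁, x₂ be elements of a commutative ring (in the paper, rational numbers), let Q(u,v) = u² + p·u·v + q·v², and set x₃ = m₁x₁ + (p·m₁ + q·m₂)x₂ and x₄ = m₂x₁ − m₁x₂. Define the cubic forms C₁(x₁,x₂,x₃,x₄) = x₁²x₃ + q·x₂²x₃ + p·q·x₂²x₄ and C₂(x₁,x₂,x₃,x₄) = x₁²x₄ − p·x₂²x₃ − (p²−q)·x₂²x₄. Then the following identities hold: (i) Q(x₃,x₄) = Q(m₁,m₂)·Q(x₁,x₂); (ii) C₁(x₁,x₂,x₃,x₄) = (m₁x₁ + q·m₂x₂)·Q(x₁,x₂); (iii) C₂(x₁,x₂,x₃,x₄) = (m₂x₁ − (m₁ +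 p·m₂)x₂)·Q(x₁,x₂). -/
/-- The identities (35) of the paper, for the binary quadratic form
`Q(u,v) = u² + puv + qv²`, the cubic forms `C₁`, `C₂`, and the bilinear
substitution `x₃ = m₁x₁ + (pm₁+qm₂)x₂`, `x₄ = m₂x₁ − m₁x₂`. -/
theorem stmt_5 {R : Type*} [CommRing R] (p q m₁ m₂ x₁ x₂ : R) :
    let Q : R → R → R := fun u v => u ^ 2 + p * u * v + q * v ^ 2
    let C₁ : R → R → R → R → R := fun y₁ y₂ y₃ y₄ =>
      y₁ ^ 2 * y₃ + q * y₂ ^ 2 * y₃ + p * q * y₂ ^ 2 * y₄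
    let C₂ : R → R → R → R → R := fun y₁ y₂ y₃ y₄ =>
      y₁ ^ 2 * y₄ - p * y₂ ^ 2 * y₃ - (p ^ 2 - q) * y₂ ^ 2 * y₄
    let x₃ := m₁ * x₁ + (p * m₁ + q * m₂) * x₂
    let x₄ := m₂ * x₁ - m₁ * x₂
    Q x₃ x₄ = Q m₁ m₂ * Q x₁ x₂
    ∧ C₁ x₁ x₂ x₃ x₄ = (m₁ * x₁ + q * m₂ * x₂) * Q x₁ x₂
    ∧ C₂ x₁ x₂ x₃ x₄ = (m₂ * x₁ - (m₁ + p * m₂) * x₂) * Q x₁ x₂ := by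
  intro Q C₁ C₂ x₃ x₄
  refine ⟨?_, ?_, ?_⟩ <;> simp only [Q, C₁, C₂, x₃, x₄] <;> ring
end

section
/- Let p, q, x₁, x₂, x₃, x₄, m₁, m₂, m₃, m₄ be elements of a commutative ring (in the paper, rational numbers). Define the quartic form F(x₁,x₂,x₃,x₄) = x₁⁴ − 2p·x₁³x₃ + p·x₁²x₂² − (2p²−4q)·x₁²x₂x₄ + (p²+2q)·x₁²x₃² + p(p²−3q)·x₁²x₄² − 4q·x₁x₂²x₃ + 4pq·x₁x₂x₃x₄ − 2pq·x₁x₃³ − 2q(p²−2q)·x₁x₃x₄² + q·x₂⁴ − 2pq·x₂³x₄ + pq·x₂²x₃² + q(p²+2q)·x₂²x₄² − 4q²·x₂x₃²x₄ − 2pq²·x₂x₄³ + q²·x₃⁴ + pq²·x₃²x₄² + q³·x₄⁴. Set x₅ = m₁x₁ − q·m₄x₂ − q·m₃x₃ − q(m₂ − p·m₄)x₄, x₆ = m₂x₁ + m₁x₂ − q·m₄x₃ − q·m₃x₄, x₇ = m₃x₁ + (m₂ − p·m₄)x₂ + (m₁ − p·m₃)x₃ − (p·m₂ − (p²−q)·m₄)x₄,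 and x₈ = m₄x₁ + m₃x₂ + (m₂ − p·m₄)x₃ + (m₁ − p·m₃)x₄. Then F(x₁,x₂,x₃,x₄)·F(m₁,m₂,m₃,m₄) = F(x₅,x₆,x₇,x₈). -/
/-- The quartic norm form of Section 7 of the paper (identity (74)). -/
def quarticForm {R : Type*} [CommRing R] (p q x₁ x₂ x₃ x₄ : R) : R :=
  x₁ ^ 4 - 2 * p * x₁ ^ 3 * x₃ + p * x₁ ^ 2 * x₂ ^ 2
    - (2 * p ^ 2 - 4 * q) * x₁ ^ 2 * x₂ * x₄ + (p ^ 2 + 2 * q) * x₁ ^ 2 * x₃ ^ 2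
    + p * (p ^ 2 - 3 * q) * x₁ ^ 2 * x₄ ^ 2 - 4 * q * x₁ * x₂ ^ 2 * x₃
    + 4 * p * q * x₁ * x₂ * x₃ * x₄ - 2 * p * q * x₁ * x₃ ^ 3
    - 2 * q * (p ^ 2 - 2 * q) * x₁ * x₃ * x₄ ^ 2 + q * x₂ ^ 4
    - 2 * p * q * x₂ ^ 3 * x₄ + p * q * x₂ ^ 2 * x₃ ^ 2
    + q * (p ^ 2 + 2 * q) * x₂ ^ 2 * x₄ ^ 2 - 4 * q ^ 2 * x₂ * x₃ ^ 2 * x₄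
    - 2 * p * q ^ 2 * x₂ * x₄ ^ 3 + q ^ 2 * x₃ ^ 4 + p * q ^ 2 * x₃ ^ 2 * x₄ ^ 2
    + q ^ 3 * x₄ ^ 4

/-- The constant coefficient of the relative norm of `x₁ + x₂ t + x₃ t² + x₄ t³`, where
`t⁴ + p t² + q = 0`, written in terms of `1, t²`. -/
def relNormConst {R : Type*} [CommRing R] (p q x₁ x₂ x₃ x₄ : R) : R :=
  x₁ ^ 2 - q * x₃ ^ 2 + 2 * q * x₂ * x₄ - p * q * x₄ ^ 2

/-- The coefficient of `t²` in the relative norm of `x₁ + x₂ t + x₃ t² + x₄ t³`, where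
`t⁴ + p t² + q = 0`, written in terms of `1, t²`. -/
def relNormLinear {R : Type*} [CommRing R] (p q x₁ x₂ x₃ x₄ : R) : R :=
  2 * x₁ * x₃ - p * x₃ ^ 2 - x₂ ^ 2 + 2 * p * x₂ * x₄ - (p ^ 2 - q) * x₄ ^ 2

/-- The quartic form is the quadratic norm of the relative norm. -/
theorem quarticForm_eq_relNorm {R : Type*} [CommRing R] (p q x₁ x₂ x₃ x₄ : R) :
    quarticForm p q x₁ x₂ x₃ x₄ =
      relNormConst p q x₁ x₂ x₃ x₄ ^ 2
        - p * relNormConst p q x₁ x₂ x₃ x₄ * relNormLinear p q x₁ x₂ x₃ x₄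
        + q * relNormLinear p q x₁ x₂ x₃ x₄ ^ 2 := by
  unfold quarticForm relNormConst relNormLinear
  ring

/-- The composition-of-quartic-forms identity (74) of the paper. -/
theorem stmt_6 {R : Type*} [CommRing R] (p q x₁ x₂ x₃ x₄ m₁ m₂ m₃ m₄ : R) :
    let x₅ := m₁ * x₁ - q * m₄ * x₂ - q * m₃ * x₃ - q * (m₂ - p * m₄) * x₄
    let x₆ := m₂ * x₁ + m₁ * x₂ - q * m₄ * x₃ - q * m₃ * x₄
    let x₇ := m₃ * x₁ + (m₂ - p * m₄) * x₂ + (m₁ - p * m₃) * x₃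
      - (p * m₂ - (p ^ 2 - q) * m₄) * x₄
    let x₈ := m₄ * x₁ + m₃ * x₂ + (m₂ - p * m₄) * x₃ + (m₁ - p * m₃) * x₄
    quarticForm p q x₁ x₂ x₃ x₄ * quarticForm p q m₁ m₂ m₃ m₄
      = quarticForm p q x₅ x₆ x₇ x₈ := by
  intro x₅ x₆ x₇ x₈
  have hconst : relNormConst p q x₅ x₆ x₇ x₈ =
      relNormConst p q x₁ x₂ x₃ x₄ * relNormConst p q m₁ m₂ m₃ m₄
        - q * relNormLinear p q x₁ x₂ x₃ x₄ * relNormLinear p q m₁ m₂ m₃ m₄ := by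
    simp only [relNormConst, relNormLinear, x₅, x₆, x₇, x₈]
    ring
  have hlinear : relNormLinear p q x₅ x₆ x₇ x₈ =
      relNormConst p q x₁ x₂ x₃ x₄ * relNormLinear p q m₁ m₂ m₃ m₄
        + relNormLinear p q x₁ x₂ x₃ x₄ * relNormConst p q m₁ m₂ m₃ m₄
        - p * relNormLinear p q x₁ x₂ x₃ x₄ * relNormLinear p q m₁ m₂ m₃ m₄ := by
    simp only [relNormConst, relNormLinear, x₅, x₆, x₇, x₈]
    ring
  rw [quarticForm_eq_relNorm, quarticForm_eq_relNorm, quarticForm_eq_relNorm, hconst, hlinear]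
  ring
end

section
/- Let t be a nonnegative integer and let α, β be integers with α ≡ 1 (mod 3) and β ≡ 1 (mod 3) such that (x₁,x₂,x₃,x₄) = (3^t, 3^t, α, β) satisfies the equation x₁⁴ − 11x₁²x₂² + x₂⁴ + x₃⁴ + 6x₃³x₄ + 7x₃²x₄² − 6x₃x₄³ + x₄⁴ = 0. Then (x₁,x₂,x₃,x₄) = (3^{t+1}, 3^{t+1}, −α+2β, 2α+5β) also satisfies this equation, and moreover −α+2β ≡ 1 (mod 3) and 2α+5β ≡ 1 (mod 3). -/
/-- The quartic form of the `h = 0` case of Section 3.2 of the paper. -/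
def quarticH0 (x₁ x₂ x₃ x₄ : ℤ) : ℤ :=
  x₁ ^ 4 - 11 * x₁ ^ 2 * x₂ ^ 2 + x₂ ^ 4 + x₃ ^ 4 + 6 * x₃ ^ 3 * x₄
    + 7 * x₃ ^ 2 * x₄ ^ 2 - 6 * x₃ * x₄ ^ 3 + x₄ ^ 4

/-- The `RC` step of Section 3.2 (case `h = 0`): from the solution
`(3^t, 3^t, α, β)` with `α ≡ β ≡ 1 (mod 3)` one obtains the solution
`(3^(t+1), 3^(t+1), −α+2β, 2α+5β)`, again with both last coordinates
`≡ 1 (mod 3)`. -/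
theorem stmt_8 (t : ℕ) (α β : ℤ) (hα : α ≡ 1 [ZMOD 3]) (hβ : β ≡ 1 [ZMOD 3])
    (h : quarticH0 (3 ^ t) (3 ^ t) α β = 0) :
    quarticH0 (3 ^ (t + 1)) (3 ^ (t + 1)) (-α + 2 * β) (2 * α + 5 * β) = 0
    ∧ (-α + 2 * β) ≡ 1 [ZMOD 3] ∧ (2 * α + 5 * β) ≡ 1 [ZMOD 3] := by
  refine ⟨?_, ?_, ?_⟩
  · unfold quarticH0 at h ⊢
    rw [pow_succ]
    linear_combination 81 * h
  · simpa using (hα.neg.add (hβ.mul_left 2))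
  · exact ((hα.mul_left 2).add (hβ.mul_left 5)).trans (by decide)
end

section
/- The homogeneous degree-10 diophantine equation (x₁²+2x₂²)⁴(x₁²+x₂²) + (x₁²+2x₂²)³(x₃²+2x₄²)(2x₁²+3x₂²) − (x₃²+2x₄²)⁵ + (x₁²+2x₂²)³(x₁⁴+4x₁²x₂²+4x₂⁴−4x₂²x₃²−8x₂²x₄²−x₃⁴−4x₃²x₄²−4x₄⁴) = 0 has infinitely many pairwise non-proportional integer solutions; in particular, starting from (1,1,1,1) one obtains an infinite sequence of such solutions with (x₁,x₂) = (3^t, 3^t) for t = 0, 1, 2, …. -/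
/-- The degree-10 form of the `h = 0` case of Section 5 of the paper. -/
def decicH0 (v : Fin 4 → ℤ) : ℤ :=
  (v 0 ^ 2 + 2 * v 1 ^ 2) ^ 4 * (v 0 ^ 2 + v 1 ^ 2)
    + (v 0 ^ 2 + 2 * v 1 ^ 2) ^ 3 * (v 2 ^ 2 + 2 * v 3 ^ 2) * (2 * v 0 ^ 2 + 3 * v 1 ^ 2)
    - (v 2 ^ 2 + 2 * v 3 ^ 2) ^ 5
    + (v 0 ^ 2 + 2 * v 1 ^ 2) ^ 3 *
      (v 0 ^ 4 + 4 * v 0 ^ 2 * v 1 ^ 2 + 4 * v 1 ^ 4 - 4 * v 1 ^ 2 * v 2 ^ 2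
        - 8 * v 1 ^ 2 * v 3 ^ 2 - v 2 ^ 4 - 4 * v 2 ^ 2 * v 3 ^ 2 - 4 * v 3 ^ 4)

/-- Two integer quadruples are proportional if one is a rational multiple of
the other. -/
def Proportional (v w : Fin 4 → ℤ) : Prop :=
  ∃ k : ℚ, (fun i => (w i : ℚ)) = fun i => k * (v i : ℚ)

/-- Coefficients `(c, d)` of `c + d√-2 = (1 + √-2) ^ (2 * t + 1)`. -/
def oddPowCoeffs : ℕ → ℤ × ℤ
  | 0 => (1, 1)
  | t + 1 => (-(oddPowCoeffs t).1 - 4 * (oddPowCoeffs t).2,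
      2 * (oddPowCoeffs t).1 - (oddPowCoeffs t).2)

lemma oddPowCoeffs_norm (t : ℕ) :
    (oddPowCoeffs t).1 ^ 2 + 2 * (oddPowCoeffs t).2 ^ 2 = 3 * (3 ^ t) ^ 2 := by
  induction t with
  | zero => norm_num [oddPowCoeffs]
  | succ t ih =>
    simp only [oddPowCoeffs, pow_succ (3 : ℤ) t]
    linear_combination 9 * ih

lemma oddPowCoeffs_mod_three (t : ℕ) :
    (oddPowCoeffs t).1 % 3 = 1 ∧ (oddPowCoeffs t).2 % 3 = 1 := by
  induction t with
  | zero => norm_num [oddPowCoeffs]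
  | succ t ih =>
    simp only [oddPowCoeffs]
    omega

/-- The form vanishes when `x₁ = x₂` and `x₁² + 2x₂² = x₃² + 2x₄²`. -/
lemma decicH0_eq_zero {a c d : ℤ} (h : c ^ 2 + 2 * d ^ 2 = 3 * a ^ 2) :
    decicH0 ![a, a, c, d] = 0 := by
  have hc : c ^ 2 = 3 * a ^ 2 - 2 * d ^ 2 := by linarith
  have hc4 : c ^ 4 = (3 * a ^ 2 - 2 * d ^ 2) ^ 2 := by rw [← hc]; ring
  simp only [decicH0, Matrix.cons_val]
  rw [hc4, hc]
  ring

/-- The solution with first two coordinates `3 ^ t`. -/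
def decicSolution (t : ℕ) : Fin 4 → ℤ :=
  ![3 ^ t, 3 ^ t, (oddPowCoeffs t).1, (oddPowCoeffs t).2]

lemma le_of_three_pow_mul_eq {s t : ℕ} {c d : ℤ} (hd : ¬ 3 ∣ d)
    (h : 3 ^ s * d = 3 ^ t * c) : t ≤ s := by
  by_contra! hlt
  obtain ⟨k, rfl⟩ := Nat.exists_eq_add_of_lt hlt
  refine hd ⟨3 ^ k * c, mul_left_cancel₀ (pow_ne_zero s (three_ne_zero (α := ℤ))) ?_⟩
  rw [h]
  ring

lemma eq_of_proportional_decicSolution {s t : ℕ}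
    (h : Proportional (decicSolution s) (decicSolution t)) : s = t := by
  obtain ⟨k, hk⟩ := h
  have h0 := congrFun hk 0
  have h2 := congrFun hk 2
  simp only [decicSolution, Matrix.cons_val] at h0 h2
  have key : (3 : ℤ) ^ s * (oddPowCoeffs t).1 = 3 ^ t * (oddPowCoeffs s).1 := by
    have : ((3 ^ s : ℤ) : ℚ) * (oddPowCoeffs t).1 = ((3 ^ t : ℤ) : ℚ) * (oddPowCoeffs s).1 := by
      rw [h0, h2]
      ring
    exact_mod_cast this
  have hs := oddPowCoeffs_mod_three s
  have ht := oddPowCoeffs_mod_three t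
  exact le_antisymm (le_of_three_pow_mul_eq (by omega) key.symm)
    (le_of_three_pow_mul_eq (by omega) key)

/-- The degree-10 equation (`h = 0` case of Section 5) has infinitely many
pairwise non-proportional nonzero integer solutions; in particular there are
such solutions with `(x₁, x₂) = (3^t, 3^t)` for every `t`. -/
theorem stmt_10 : ∃ S : Set (Fin 4 → ℤ), S.Infinite
    ∧ (∀ v ∈ S, v ≠ 0 ∧ decicH0 v = 0)
    ∧ (∀ v ∈ S, ∀ w ∈ S, v ≠ w → ¬ Proportional v w)
    ∧ (∀ t : ℕ, ∃ v ∈ S, v 0 = 3 ^ t ∧ v 1 = 3 ^ t) := by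
  refine ⟨Set.range decicSolution, Set.infinite_range_of_injective ?_, ?_, ?_, ?_⟩
  · intro s t h
    exact eq_of_proportional_decicSolution ⟨1, by simp [h]⟩
  · rintro _ ⟨t, rfl⟩
    refine ⟨fun h => ?_, decicH0_eq_zero (oddPowCoeffs_norm t)⟩
    simpa [decicSolution] using congrFun h 0
  · rintro _ ⟨s, rfl⟩ _ ⟨t, rfl⟩ hne h
    exact hne (congrArg decicSolution (eq_of_proportional_decicSolution h))
  · exact fun t => ⟨decicSolution t, ⟨t, rfl⟩, rfl, rfl⟩
end

section
/- For all rational numbers m₁ and m₂, the value d(m₁,m₂) = 45m₁⁸+180m₁⁷m₂+810m₁⁶m₂²+1800m₁⁵m₂³+4095m₁⁴m₂⁴+5400m₁³m₂⁵+7290m₁²m₂⁶+4860m₁m₂⁷+3645m₂⁸+180m₁⁶m₂+540m₁⁵m₂²+2160m₁⁴m₂³+3420m₁³m₂⁴+6480m₁²m₂⁵+4860m₁m₂⁶+4860m₂⁷+1044m₁⁶+3384m₁⁵m₂+9000m₁⁴m₂²+13536m₁³m₂³+10872m₁²m₂⁴+6264m₁m₂⁵−8100m₂⁶+60m₁⁵+492m₁⁴m₂+324m₁³m₂²+2628m₁²m₂³+756m₁m₂⁴+4860m₂⁵−3036m₁⁴−5112m₁³m₂−15648m₁²m₂²−10512m₁m₂³−13176m₂⁴−192m₁³−504m₁²m₂−720m₁m₂²−1512m₂³+2908m₁²+3048m₁m₂+8244m₂²−264m₁−792m₂−396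 is nonzero; that is, the equation d(m₁,m₂) = 0 has no rational solutions. -/
/-- The discriminant polynomial `d(m₁, m₂)` of Section 3.3 of the paper. -/
def discQuartic (m₁ m₂ : ℚ) : ℚ :=
  45*m₁^8 + 180*m₁^7*m₂ + 810*m₁^6*m₂^2 + 1800*m₁^5*m₂^3 + 4095*m₁^4*m₂^4
    + 5400*m₁^3*m₂^5 + 7290*m₁^2*m₂^6 + 4860*m₁*m₂^7 + 3645*m₂^8
    + 180*m₁^6*m₂ + 540*m₁^5*m₂^2 + 2160*m₁^4*m₂^3 + 3420*m₁^3*m₂^4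
    + 6480*m₁^2*m₂^5 + 4860*m₁*m₂^6 + 4860*m₂^7
    + 1044*m₁^6 + 3384*m₁^5*m₂ + 9000*m₁^4*m₂^2 + 13536*m₁^3*m₂^3
    + 10872*m₁^2*m₂^4 + 6264*m₁*m₂^5 - 8100*m₂^6
    + 60*m₁^5 + 492*m₁^4*m₂ + 324*m₁^3*m₂^2 + 2628*m₁^2*m₂^3 + 756*m₁*m₂^4
    + 4860*m₂^5
    - 3036*m₁^4 - 5112*m₁^3*m₂ - 15648*m₁^2*m₂^2 - 10512*m₁*m₂^3 - 13176*m₂^4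
    - 192*m₁^3 - 504*m₁^2*m₂ - 720*m₁*m₂^2 - 1512*m₂^3
    + 2908*m₁^2 + 3048*m₁*m₂ + 8244*m₂^2 - 264*m₁ - 792*m₂ - 396

/-- The degree-8 homogenization of `discQuartic`, with `z` the homogenizing variable. -/
def discForm {R : Type*} [CommRing R] (x y z : R) : R :=
  45*x^8 + 180*x^7*y + 810*x^6*y^2 + 1800*x^5*y^3 + 4095*x^4*y^4 + 5400*x^3*y^5 + 7290*x^2*y^6
    + 4860*x*y^7 + 3645*y^8 + 180*z*x^6*y + 540*z*x^5*y^2 + 2160*z*x^4*y^3 + 3420*z*x^3*y^4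
    + 6480*z*x^2*y^5 + 4860*z*x*y^6 + 4860*z*y^7 + 1044*z^2*x^6 + 3384*z^2*x^5*y
    + 9000*z^2*x^4*y^2 + 13536*z^2*x^3*y^3 + 10872*z^2*x^2*y^4 + 6264*z^2*x*y^5 - 8100*z^2*y^6
    + 60*z^3*x^5 + 492*z^3*x^4*y + 324*z^3*x^3*y^2 + 2628*z^3*x^2*y^3 + 756*z^3*x*y^4
    + 4860*z^3*y^5 - 3036*z^4*x^4 - 5112*z^4*x^3*y - 15648*z^4*x^2*y^2 - 10512*z^4*x*y^3
    - 13176*z^4*y^4 - 192*z^5*x^3 - 504*z^5*x^2*y - 720*z^5*x*y^2 - 1512*z^5*y^3 + 2908*z^6*x^2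
    + 3048*z^6*x*y + 8244*z^6*y^2 - 264*z^7*x - 792*z^7*y - 396*z^8

lemma discForm_eq_pow_mul_discQuartic {x y z : ℚ} (hz : z ≠ 0) :
    discForm x y z = z ^ 8 * discQuartic (x / z) (y / z) := by
  unfold discForm discQuartic
  field_simp

lemma discForm_mul {R : Type*} [CommRing R] (t x y z : R) :
    discForm (t * x) (t * y) (t * z) = t ^ 8 * discForm x y z := by
  unfold discForm
  ring

lemma discForm_intCast {R : Type*} [CommRing R] (x y z : ℤ) :
    ((discForm x y z : ℤ) : R) = discForm (x : R) y z := by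
  unfold discForm
  push_cast
  rfl

lemma even_and_even_of_discForm_eq_zero {x y z : ℤ} (h : discForm x y z = 0) :
    Even x ∧ Even y := by
  have key : ∀ a b c : ZMod 2, discForm a b c = 0 → a = 0 ∧ b = 0 := by
    unfold discForm
    decide
  have h₂ : discForm (x : ZMod 2) y z = 0 := by
    rw [← discForm_intCast, h, Int.cast_zero]
  simpa only [ZMod.intCast_eq_zero_iff_even] using key _ _ _ h₂

lemma discForm_two_mul_two_mul (x y z : ℤ) :
    ∃ k, discForm (2 * x) (2 * y) z = 8 * k - 396 * z ^ 8 := by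
  refine ⟨1440*x^8 + 5760*x^7*y + 25920*x^6*y^2 + 57600*x^5*y^3 + 131040*x^4*y^4 + 172800*x^3*y^5
    + 233280*x^2*y^6 + 155520*x*y^7 + 116640*y^8 + 2880*z*x^6*y + 8640*z*x^5*y^2
    + 34560*z*x^4*y^3 + 54720*z*x^3*y^4 + 103680*z*x^2*y^5 + 77760*z*x*y^6 + 77760*z*y^7
    + 8352*z^2*x^6 + 27072*z^2*x^5*y + 72000*z^2*x^4*y^2 + 108288*z^2*x^3*y^3
    + 86976*z^2*x^2*y^4 + 50112*z^2*x*y^5 - 64800*z^2*y^6 + 240*z^3*x^5 + 1968*z^3*x^4*y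
    + 1296*z^3*x^3*y^2 + 10512*z^3*x^2*y^3 + 3024*z^3*x*y^4 + 19440*z^3*y^5 - 6072*z^4*x^4
    - 10224*z^4*x^3*y - 31296*z^4*x^2*y^2 - 21024*z^4*x*y^3 - 26352*z^4*y^4 - 192*z^5*x^3
    - 504*z^5*x^2*y - 720*z^5*x*y^2 - 1512*z^5*y^3 + 1454*z^6*x^2 + 1524*z^6*x*y + 4122*z^6*y^2
    - 66*z^7*x - 198*z^7*y, ?_⟩
  unfold discForm
  ring

lemma even_of_discForm_two_mul_eq_zero {x y z : ℤ} (h : discForm (2 * x) (2 * y) z = 0) :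
    Even z := by
  obtain ⟨k, hk⟩ := discForm_two_mul_two_mul x y z
  have hz : Even (z ^ 8) := by
    rw [Int.even_iff]
    omega
  exact (Int.even_pow.mp hz).1

/-- The integral zeros of `discForm` admit a 2-adic descent, hence have `z = 0`. -/
lemma discForm_ne_zero {x y z : ℤ} (hz : z ≠ 0) : discForm x y z ≠ 0 := by
  intro h
  induction hn : z.natAbs using Nat.strong_induction_on generalizing x y z with
  | _ n ih =>
    obtain ⟨hx, hy⟩ := even_and_even_of_discForm_eq_zero h
    obtain ⟨x, rfl⟩ := hx.two_dvd
    obtain ⟨y, rfl⟩ := hy.two_dvd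
    obtain ⟨z, rfl⟩ := (even_of_discForm_two_mul_eq_zero h).two_dvd
    rw [discForm_mul] at h
    exact ih z.natAbs (by omega) (by omega) (by simpa using h) rfl

/-- `d(m₁, m₂) = 0` has no rational solutions (Section 3.3 of the paper). -/
theorem stmt_11 (m₁ m₂ : ℚ) : discQuartic m₁ m₂ ≠ 0 := by
  intro h
  have hd₁ : (m₁.den : ℚ) ≠ 0 := by exact_mod_cast m₁.den_nz
  have hd₂ : (m₂.den : ℚ) ≠ 0 := by exact_mod_cast m₂.den_nz
  have h₁ : (m₁.num * m₂.den : ℚ) / (m₁.den * m₂.den) = m₁ := by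
    rw [mul_div_mul_right _ _ hd₂, Rat.num_div_den]
  have h₂ : (m₂.num * m₁.den : ℚ) / (m₁.den * m₂.den) = m₂ := by
    rw [mul_comm (m₁.den : ℚ), mul_div_mul_right _ _ hd₁, Rat.num_div_den]
  have hz : (m₁.den * m₂.den : ℤ) ≠ 0 := by exact_mod_cast mul_ne_zero m₁.den_nz m₂.den_nz
  refine discForm_ne_zero (x := m₁.num * m₂.den) (y := m₂.num * m₁.den) hz ?_
  have hq := discForm_eq_pow_mul_discQuartic (x := m₁.num * m₂.den) (y := m₂.num * m₁.den)
    (mul_ne_zero hd₁ hd₂)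
  rw [h₁, h₂, h, mul_zero] at hq
  rw [← Int.cast_inj (α := ℚ), discForm_intCast]
  push_cast
  exact hq
end

section
/- The homogeneous quartic diophantine equation 6x₁⁴+(30x₂²+10x₂x₃−6x₂x₄−9x₃²−3x₃x₄−9x₄²)x₁²+54x₂⁴+36x₂³x₃+18x₂³x₄−105x₂²x₃²−105x₂²x₃x₄−261x₂²x₄²+12x₂x₃³+18x₂x₃²x₄+42x₂x₃x₄²+18x₂x₄³+3x₃⁴+6x₃³x₄+9x₃²x₄²+6x₃x₄³−9x₄⁴ = 0 has infinitely many pairwise non-proportional integer solutions; that is, there exists an infinite set of nonzero integer quadruples (x₁,x₂,x₃,x₄) satisfying the equation, no two of which are rational multiples of one another. -/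
/-- The quartic form of Section 3.3 of the paper. -/
def quarticSec33 (v : Fin 4 → ℤ) : ℤ :=
  6 * v 0 ^ 4
    + (30 * v 1 ^ 2 + 10 * v 1 * v 2 - 6 * v 1 * v 3 - 9 * v 2 ^ 2
        - 3 * v 2 * v 3 - 9 * v 3 ^ 2) * v 0 ^ 2
    + 54 * v 1 ^ 4 + 36 * v 1 ^ 3 * v 2 + 18 * v 1 ^ 3 * v 3
    - 105 * v 1 ^ 2 * v 2 ^ 2 - 105 * v 1 ^ 2 * v 2 * v 3 - 261 * v 1 ^ 2 * v 3 ^ 2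
    + 12 * v 1 * v 2 ^ 3 + 18 * v 1 * v 2 ^ 2 * v 3 + 42 * v 1 * v 2 * v 3 ^ 2
    + 18 * v 1 * v 3 ^ 3 + 3 * v 2 ^ 4 + 6 * v 2 ^ 3 * v 3 + 9 * v 2 ^ 2 * v 3 ^ 2
    + 6 * v 2 * v 3 ^ 3 - 9 * v 3 ^ 4

/-! The quartic surface contains the two conjugate skew lines `a = θ b`, `c = (θ - 1) d`, where
`θ ^ 2 - θ + 3 = 0`. Through a point there is one line meeting both, and its fourth intersection with
the surface defines a birational involution. It has no rational fixed point, whereas another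
involution on the rational points has exactly one; hence there are infinitely many of them. -/

/-- Multiplication by `θ`, in coordinates adapted to the two skew lines. -/
def mulTheta (v : Fin 4 → ℤ) : Fin 4 → ℤ := ![v 0 - 3 * v 1, v 0, -3 * v 3, v 2 + v 3]

/-- Multiplication by `x + y θ`. -/
def twist (x y : ℤ) (v : Fin 4 → ℤ) : Fin 4 → ℤ := fun i => x * v i + y * mulTheta v i

/-- The rational part of the coefficient `A = normRe + normIm * θ` such that
`11 * quarticSec33 (s • v) = N s * (A * s ^ 2 + B * N s + conj A * conj s ^ 2)`. -/
def normRe (v : Fin 4 → ℤ) : ℤ :=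
    72 * v 0 ^ 3 * v 1 + 6 * v 0 ^ 3 * v 2 + 36 * v 0 ^ 3 * v 3 - 108 * v 0 ^ 2 * v 1 ^ 2
    + 12 * v 0 ^ 2 * v 1 * v 2 - 126 * v 0 ^ 2 * v 1 * v 3 + 60 * v 0 ^ 2 * v 2 ^ 2
    + 96 * v 0 ^ 2 * v 2 * v 3 + 288 * v 0 ^ 2 * v 3 ^ 2 + 252 * v 0 * v 1 ^ 3
    + 66 * v 0 * v 1 ^ 2 * v 2 + 198 * v 0 * v 1 ^ 2 * v 3 - 174 * v 0 * v 1 * v 2 ^ 2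
    - 210 * v 0 * v 1 * v 2 * v 3 - 630 * v 0 * v 1 * v 3 ^ 2 + 6 * v 0 * v 2 ^ 3
    + 42 * v 0 * v 2 ^ 2 * v 3 + 54 * v 0 * v 2 * v 3 ^ 2 + 108 * v 0 * v 3 ^ 3 - 108 * v 1 ^ 4
    + 54 * v 1 ^ 3 * v 2 - 72 * v 1 ^ 3 * v 3 - 183 * v 1 ^ 2 * v 2 ^ 2
    - 75 * v 1 ^ 2 * v 2 * v 3 - 225 * v 1 ^ 2 * v 3 ^ 2 + 30 * v 1 * v 2 ^ 3
    + 12 * v 1 * v 2 ^ 2 * v 3 + 72 * v 1 * v 2 * v 3 ^ 2 - 54 * v 1 * v 3 ^ 3 + 12 * v 2 ^ 4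
    + 12 * v 2 ^ 3 * v 3 - 36 * v 2 * v 3 ^ 3 - 108 * v 3 ^ 4

/-- The `θ`-part of the same coefficient. -/
def normIm (v : Fin 4 → ℤ) : ℤ :=
    -12 * v 0 ^ 4 + 12 * v 0 ^ 3 * v 1 - 10 * v 0 ^ 3 * v 2 + 6 * v 0 ^ 3 * v 3
    + 6 * v 0 ^ 2 * v 1 * v 2 + 36 * v 0 ^ 2 * v 1 * v 3 + 3 * v 0 ^ 2 * v 2 ^ 2
    - 33 * v 0 ^ 2 * v 2 * v 3 + 9 * v 0 ^ 2 * v 3 ^ 2 - 36 * v 0 * v 1 ^ 3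
    - 48 * v 0 * v 1 ^ 2 * v 2 - 90 * v 0 * v 1 ^ 2 * v 3 + 156 * v 0 * v 1 * v 2 ^ 2
    + 192 * v 0 * v 1 * v 2 * v 3 + 468 * v 0 * v 1 * v 3 ^ 2 - 12 * v 0 * v 2 ^ 3
    - 18 * v 0 * v 2 ^ 2 * v 3 - 42 * v 0 * v 2 * v 3 ^ 2 - 18 * v 0 * v 3 ^ 3 + 108 * v 1 ^ 4
    + 54 * v 1 ^ 3 * v 2 + 126 * v 1 ^ 3 * v 3 - 105 * v 1 ^ 2 * v 2 ^ 2
    - 213 * v 1 ^ 2 * v 2 * v 3 - 315 * v 1 ^ 2 * v 3 ^ 2 + 6 * v 1 * v 2 ^ 3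
    + 42 * v 1 * v 2 ^ 2 * v 3 + 54 * v 1 * v 2 * v 3 ^ 2 + 108 * v 1 * v 3 ^ 3
    + 24 * v 2 ^ 3 * v 3 + 36 * v 2 ^ 2 * v 3 ^ 2 + 84 * v 2 * v 3 ^ 3 + 36 * v 3 ^ 4

theorem quarticSec33_twist (x y : ℤ) (v : Fin 4 → ℤ) :
    11 * quarticSec33 (twist x y v) = (x ^ 2 + x * y + 3 * y ^ 2) *
      ((2 * normRe v + normIm v) * (x ^ 2 - 3 * y ^ 2)
        + (normRe v - 5 * normIm v) * (2 * x * y + y ^ 2)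
        + (11 * quarticSec33 v - 2 * normRe v - normIm v) * (x ^ 2 + x * y + 3 * y ^ 2)) := by
  simp only [quarticSec33, twist, mulTheta, normRe, normIm, Matrix.cons_val]
  ring

theorem normRe_twist (x y : ℤ) (v : Fin 4 → ℤ) :
    normRe (twist x y v) = (x ^ 2 + x * y + 3 * y ^ 2) *
      (normRe v * (x ^ 2 - 3 * y ^ 2) - 3 * normIm v * (2 * x * y + y ^ 2)) := by
  simp only [twist, mulTheta, normRe, normIm, Matrix.cons_val]
  ring

theorem normIm_twist (x y : ℤ) (v : Fin 4 → ℤ) :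
    normIm (twist x y v) = (x ^ 2 + x * y + 3 * y ^ 2) *
      ((normRe v + normIm v) * (2 * x * y + y ^ 2) + normIm v * (x ^ 2 - 3 * y ^ 2)) := by
  simp only [twist, mulTheta, normRe, normIm, Matrix.cons_val]
  ring

theorem twist_twist (x y z w : ℤ) (v : Fin 4 → ℤ) :
    twist x y (twist z w v) = twist (x * z - 3 * y * w) (x * w + y * z + y * w) v := by
  funext i
  fin_cases i <;> simp [twist, mulTheta] <;> ring

theorem smul_eq_twist (m : ℤ) (v : Fin 4 → ℤ) : m • v = twist m 0 v := by
  funext i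
  simp [twist]

/-- The norm of `normRe v + normIm v * θ`. -/
def coeffNorm (v : Fin 4 → ℤ) : ℤ := normRe v ^ 2 + normRe v * normIm v + 3 * normIm v ^ 2

/-- The residual intersection of the quartic surface with the line through `v` that meets both
skew lines. -/
def residualVec (v : Fin 4 → ℤ) : Fin 4 → ℤ := twist (normRe v + normIm v) (-normIm v) v

theorem quarticSec33_residualVec (v : Fin 4 → ℤ) :
    quarticSec33 (residualVec v) = coeffNorm v ^ 2 * quarticSec33 v := by
  have h := quarticSec33_twist (normRe v + normIm v) (-normIm v) v
  have h11 : (11 : ℤ) ≠ 0 := by norm_num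
  apply mul_left_cancel₀ h11
  rw [residualVec, h, coeffNorm]
  ring

theorem residualVec_residualVec (v : Fin 4 → ℤ) :
    residualVec (residualVec v) = coeffNorm v ^ 3 • v := by
  rw [residualVec, residualVec, normRe_twist, normIm_twist, twist_twist, smul_eq_twist, coeffNorm]
  congr 1 <;> ring

theorem residualVec_smul (m : ℤ) (v : Fin 4 → ℤ) :
    residualVec (m • v) = m ^ 5 • residualVec v := by
  rw [smul_eq_twist, smul_eq_twist, residualVec, residualVec, normRe_twist, normIm_twist, twist_twist,
    twist_twist]
  congr 1 <;> ring

theorem quarticSec33_smul (m : ℤ) (v : Fin 4 → ℤ) :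
    quarticSec33 (m • v) = m ^ 4 * quarticSec33 v := by
  simp only [quarticSec33, Pi.smul_apply, smul_eq_mul]
  ring

theorem normIm_smul (m : ℤ) (v : Fin 4 → ℤ) : normIm (m • v) = m ^ 4 * normIm v := by
  simp only [normIm, Pi.smul_apply, smul_eq_mul]
  ring

/-- Infinite descent for a predicate on integer vectors. -/
theorem eq_zero_of_descent {ι : Type*} {p : ℤ} (hp : 1 < p) (P : (ι → ℤ) → Prop)
    (h : ∀ v, P v → ∃ w, v = p • w ∧ P w) {v : ι → ℤ} (hv : P v) : v = 0 := by
  have key : ∀ n : ℕ, ∀ v, P v → ∀ i, p ^ n ∣ v i := by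
    intro n
    induction n with
    | zero => simp
    | succ n ih =>
      intro v hv i
      obtain ⟨w, rfl, hw⟩ := h v hv
      rw [pow_succ', Pi.smul_apply, smul_eq_mul]
      exact mul_dvd_mul_left p (ih w hw i)
  funext i
  lift p to ℕ using by omega
  refine Int.eq_zero_of_abs_lt_dvd (key (v i).natAbs v hv i) ?_
  rw [Int.abs_eq_natAbs]
  exact_mod_cast Nat.lt_pow_self (by exact_mod_cast hp)

theorem even_of_common_zero_mod_four : ∀ a b c d : ZMod 4,
    6 * a ^ 4 + (30 * b ^ 2 + 10 * b * c - 6 * b * d - 9 * c ^ 2 - 3 * c * d - 9 * d ^ 2) * a ^ 2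
      + 54 * b ^ 4 + 36 * b ^ 3 * c + 18 * b ^ 3 * d - 105 * b ^ 2 * c ^ 2 - 105 * b ^ 2 * c * d
      - 261 * b ^ 2 * d ^ 2 + 12 * b * c ^ 3 + 18 * b * c ^ 2 * d + 42 * b * c * d ^ 2
      + 18 * b * d ^ 3 + 3 * c ^ 4 + 6 * c ^ 3 * d + 9 * c ^ 2 * d ^ 2 + 6 * c * d ^ 3
      - 9 * d ^ 4 = 0 →
    -12 * a ^ 4 + 12 * a ^ 3 * b - 10 * a ^ 3 * c + 6 * a ^ 3 * d
      + 6 * a ^ 2 * b * c + 36 * a ^ 2 * b * d + 3 * a ^ 2 * c ^ 2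
      - 33 * a ^ 2 * c * d + 9 * a ^ 2 * d ^ 2 - 36 * a * b ^ 3
      - 48 * a * b ^ 2 * c - 90 * a * b ^ 2 * d + 156 * a * b * c ^ 2
      + 192 * a * b * c * d + 468 * a * b * d ^ 2 - 12 * a * c ^ 3
      - 18 * a * c ^ 2 * d - 42 * a * c * d ^ 2 - 18 * a * d ^ 3 + 108 * b ^ 4
      + 54 * b ^ 3 * c + 126 * b ^ 3 * d - 105 * b ^ 2 * c ^ 2
      - 213 * b ^ 2 * c * d - 315 * b ^ 2 * d ^ 2 + 6 * b * c ^ 3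
      + 42 * b * c ^ 2 * d + 54 * b * c * d ^ 2 + 108 * b * d ^ 3
      + 24 * c ^ 3 * d + 36 * c ^ 2 * d ^ 2 + 84 * c * d ^ 3 + 36 * d ^ 4 = 0 →
    2 * a = 0 ∧ 2 * b = 0 ∧ 2 * c = 0 ∧ 2 * d = 0 := by
  decide +kernel

theorem two_dvd_of_cast_two_mul {x : ℤ} (h : 2 * (x : ZMod 4) = 0) : 2 ∣ x := by
  have h' : ((2 * x : ℤ) : ZMod 4) = 0 := by exact_mod_cast h
  have h4 := (ZMod.intCast_zmod_eq_zero_iff_dvd _ 4).1 h'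
  omega

theorem eq_zero_of_quarticSec33_of_normIm {v : Fin 4 → ℤ} (h : quarticSec33 v = 0)
    (h' : normIm v = 0) : v = 0 := by
  refine eq_zero_of_descent (p := 2) (by norm_num)
    (fun v => quarticSec33 v = 0 ∧ normIm v = 0) ?_ ⟨h, h'⟩
  rintro v ⟨h, h'⟩
  have e := congrArg (Int.cast : ℤ → ZMod 4) h
  have e' := congrArg (Int.cast : ℤ → ZMod 4) h'
  simp only [quarticSec33] at e
  simp only [normIm] at e'
  push_cast at e e'
  obtain ⟨h0, h1, h2, h3⟩ := even_of_common_zero_mod_four _ _ _ _ e e'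
  have hd : ∀ i, 2 ∣ v i := by
    intro i
    fin_cases i
    · exact two_dvd_of_cast_two_mul h0
    · exact two_dvd_of_cast_two_mul h1
    · exact two_dvd_of_cast_two_mul h2
    · exact two_dvd_of_cast_two_mul h3
  choose w hw using hd
  obtain rfl : v = (2 : ℤ) • w := funext hw
  rw [quarticSec33_smul] at h
  rw [normIm_smul] at h'
  exact ⟨w, rfl, by simpa using h, by simpa using h'⟩

theorem eq_zero_of_cubic_mod_thirteen : ∀ b c : ZMod 13,
    c ^ 3 + 5 * b * c ^ 2 - 30 * b ^ 2 * c - 18 * b ^ 3 = 0 → b = 0 ∧ c = 0 := by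
  decide +kernel

theorem eq_zero_of_cubic {b c : ℤ}
    (h : c ^ 3 + 5 * b * c ^ 2 - 30 * b ^ 2 * c - 18 * b ^ 3 = 0) : b = 0 ∧ c = 0 := by
  have key : ![b, c] = 0 := by
    refine eq_zero_of_descent (p := 13) (by norm_num)
      (fun u : Fin 2 → ℤ =>
        u 1 ^ 3 + 5 * u 0 * u 1 ^ 2 - 30 * u 0 ^ 2 * u 1 - 18 * u 0 ^ 3 = 0) ?_ (by simpa using h)
    intro u hu
    have e := congrArg (Int.cast : ℤ → ZMod 13) hu
    push_cast at e
    obtain ⟨h0, h1⟩ := eq_zero_of_cubic_mod_thirteen _ _ e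
    have hd : ∀ i, 13 ∣ u i := by
      intro i
      fin_cases i
      · exact (ZMod.intCast_zmod_eq_zero_iff_dvd _ 13).1 h0
      · exact (ZMod.intCast_zmod_eq_zero_iff_dvd _ 13).1 h1
    choose w hw using hd
    obtain rfl : u = (13 : ℤ) • w := funext hw
    refine ⟨w, rfl, ?_⟩
    simp only [Pi.smul_apply, smul_eq_mul] at hu
    have h13 : (13 : ℤ) ^ 3 ≠ 0 := by norm_num
    apply mul_left_cancel₀ h13
    linear_combination hu
  exact ⟨by simpa using congrFun key 0, by simpa using congrFun key 1⟩

theorem coeffNorm_ne_zero {v : Fin 4 → ℤ} (hv : v ≠ 0) (h : quarticSec33 v = 0) :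
    coeffNorm v ≠ 0 := by
  intro h0
  refine hv (eq_zero_of_quarticSec33_of_normIm h ?_)
  rw [coeffNorm] at h0
  have : normIm v ^ 2 ≤ 0 := by nlinarith [sq_nonneg (2 * normRe v + normIm v)]
  exact pow_eq_zero_iff two_ne_zero |>.1 (le_antisymm this (sq_nonneg _))

theorem eq_zero_of_smul_mulTheta {k l : ℤ} {v : Fin 4 → ℤ} (hk : k ≠ 0)
    (h : k • mulTheta v = l • v) : v = 0 := by
  have hn : l ^ 2 - k * l + 3 * k ^ 2 ≠ 0 := by
    have : 0 < k ^ 2 := by positivity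
    nlinarith [sq_nonneg (2 * l - k)]
  have h0 : k * (v 0 - 3 * v 1) = l * v 0 := congrFun h 0
  have h1 : k * v 0 = l * v 1 := congrFun h 1
  have h2 : k * (-3 * v 3) = l * v 2 := congrFun h 2
  have h3 : k * (v 2 + v 3) = l * v 3 := congrFun h 3
  have e1 : v 1 = 0 := by
    apply mul_left_cancel₀ hn
    linear_combination (k - l) * h1 - k * h0
  have e3 : v 3 = 0 := by
    apply mul_left_cancel₀ hn
    linear_combination -k * h2 - l * h3
  have e0 : v 0 = 0 := by
    apply mul_left_cancel₀ hk
    rw [h1, e1]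
    ring
  have e2 : v 2 = 0 := by
    apply mul_left_cancel₀ hk
    rw [e3] at h3
    linear_combination h3
  funext i
  fin_cases i <;> assumption

/-- A nonzero integral solution of the quartic equation. -/
abbrev Solution : Type := {v : Fin 4 → ℤ // v ≠ 0 ∧ quarticSec33 v = 0}

/-- Proportionality of solutions. -/
instance solutionSetoid : Setoid Solution where
  r v w := ∃ m n : ℤ, m ≠ 0 ∧ n ≠ 0 ∧ m • v.1 = n • w.1
  iseqv :=
    { refl := fun _ => ⟨1, 1, one_ne_zero, one_ne_zero, rfl⟩
      symm := fun ⟨m, n, hm, hn, h⟩ => ⟨n, m, hn, hm, h.symm⟩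
      trans := fun {u v w} ⟨m, n, hm, hn, h⟩ ⟨m', n', hm', hn', h'⟩ =>
        ⟨m' * m, n * n', mul_ne_zero hm' hm, mul_ne_zero hn hn', by
          rw [mul_smul, h, smul_comm, h', mul_smul]⟩ }

theorem solution_equiv_iff {v w : Solution} :
    v ≈ w ↔ ∃ m n : ℤ, m ≠ 0 ∧ n ≠ 0 ∧ m • v.1 = n • w.1 := Iff.rfl

theorem equiv_of_proportional {v w : Solution} (h : Proportional v.1 w.1) : v ≈ w := by
  obtain ⟨k, hk⟩ := h
  have hk0 : k ≠ 0 := by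
    rintro rfl
    refine w.2.1 (funext fun i => ?_)
    simpa using congrFun hk i
  refine ⟨k.num, k.den, Rat.num_ne_zero.2 hk0, by exact_mod_cast k.den_ne_zero, funext fun i => ?_⟩
  have hi : (w.1 i : ℚ) = k * v.1 i := congrFun hk i
  have : (k.num : ℚ) * v.1 i = k.den * w.1 i := by
    rw [hi, ← mul_assoc, mul_comm (k.den : ℚ) k, Rat.mul_den_eq_num]
  simp only [Pi.smul_apply, smul_eq_mul]
  exact_mod_cast this

/-- Solutions up to proportionality. -/
abbrev RationalPoint : Type := Quotient solutionSetoid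

/-- The residual involution on solutions. -/
def solutionResidual (v : Solution) : Solution :=
  ⟨residualVec v.1, by
    intro h
    have h' := residualVec_residualVec v.1
    have hz : residualVec (0 : Fin 4 → ℤ) = 0 := by simpa using residualVec_smul 0 0
    rw [h, hz] at h'
    exact smul_ne_zero (pow_ne_zero 3 (coeffNorm_ne_zero v.2.1 v.2.2)) v.2.1 h'.symm, by
    rw [quarticSec33_residualVec, v.2.2, mul_zero]⟩

/-- The residual involution on rational points. -/
def pointResidual : RationalPoint → RationalPoint :=
  Quotient.map solutionResidual (by
    rintro v w ⟨m, n, hm, hn, h⟩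
    refine ⟨m ^ 5, n ^ 5, pow_ne_zero 5 hm, pow_ne_zero 5 hn, ?_⟩
    simp only [solutionResidual]
    rw [← residualVec_smul, h, residualVec_smul])

theorem pointResidual_involutive : Function.Involutive pointResidual := by
  rintro ⟨v⟩
  refine Quotient.sound ⟨1, coeffNorm v.1 ^ 3, one_ne_zero,
    pow_ne_zero 3 (coeffNorm_ne_zero v.2.1 v.2.2), ?_⟩
  rw [one_smul]
  exact residualVec_residualVec v.1

theorem pointResidual_ne (q : RationalPoint) : pointResidual q ≠ q := by
  obtain ⟨v⟩ := q
  intro h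
  obtain ⟨m, n, hm, -, e⟩ := solution_equiv_iff.1 (Quotient.exact h)
  by_cases hi : normIm v.1 = 0
  · exact v.2.1 (eq_zero_of_quarticSec33_of_normIm v.2.2 hi)
  refine v.2.1 (eq_zero_of_smul_mulTheta (k := m * normIm v.1)
    (l := m * (normRe v.1 + normIm v.1) - n) (mul_ne_zero hm hi) (funext fun i => ?_))
  have ei := congrFun e i
  simp only [solutionResidual, residualVec, twist, Pi.smul_apply, smul_eq_mul] at ei ⊢
  linear_combination -ei

/-- The reflection in `v 0` on vectors with `v 0 ≠ 0`, and an involution preserving the plane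
section on vectors with `v 0 = 0`. -/
def reflect (v : Fin 4 → ℤ) : Fin 4 → ℤ :=
  if v 0 = 0 then ![0, v 1, v 2 + v 3, -v 3] else ![-v 0, v 1, v 2, v 3]

theorem reflect_reflect (v : Fin 4 → ℤ) : reflect (reflect v) = v := by
  by_cases h : v 0 = 0
  · funext i
    fin_cases i <;> simp [reflect, h]
  · funext i
    fin_cases i <;> simp [reflect, h]

theorem quarticSec33_reflect (v : Fin 4 → ℤ) : quarticSec33 (reflect v) = quarticSec33 v := by
  by_cases h : v 0 = 0
  · simp only [reflect, h, if_true, quarticSec33, Matrix.cons_val]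
    ring
  · simp only [reflect, h, if_false, quarticSec33, Matrix.cons_val]
    ring

theorem reflect_smul {m : ℤ} (hm : m ≠ 0) (v : Fin 4 → ℤ) : reflect (m • v) = m • reflect v := by
  by_cases h : v 0 = 0
  · funext i
    fin_cases i <;> simp [reflect, h, mul_add]
  · funext i
    fin_cases i <;> simp [reflect, h, hm]

/-- The involution `reflect` on solutions. -/
def solutionReflect (v : Solution) : Solution :=
  ⟨reflect v.1, by
    intro h
    have h' := reflect_reflect v.1
    rw [h] at h'
    refine v.2.1 (h'.symm.trans (funext fun i => ?_))
    fin_cases i <;> simp [reflect], by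
    rw [quarticSec33_reflect, v.2.2]⟩

/-- The involution `reflect` on rational points. -/
def pointReflect : RationalPoint → RationalPoint :=
  Quotient.map solutionReflect (by
    rintro v w ⟨m, n, hm, hn, h⟩
    refine ⟨m, n, hm, hn, ?_⟩
    simp only [solutionReflect]
    rw [← reflect_smul hm, h, reflect_smul hn])

theorem pointReflect_involutive : Function.Involutive pointReflect := by
  rintro ⟨v⟩
  exact congrArg (Quotient.mk _) (Subtype.ext (reflect_reflect v.1))

/-- The solution `(0, 1, 1, 0)`. -/
def baseSolution : Solution :=
  ⟨![0, 1, 1, 0], fun h => one_ne_zero (congrFun h 1), by simp [quarticSec33]⟩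

theorem pointReflect_base : pointReflect ⟦baseSolution⟧ = ⟦baseSolution⟧ := by
  refine congrArg (Quotient.mk _) (Subtype.ext (funext fun i => ?_))
  fin_cases i <;> simp [solutionReflect, baseSolution, reflect]

theorem eq_base_of_pointReflect {q : RationalPoint} (h : pointReflect q = q) :
    q = ⟦baseSolution⟧ := by
  obtain ⟨v, hv, hF⟩ := q
  obtain ⟨m, n, hm, hn, e⟩ := solution_equiv_iff.1 (Quotient.exact h)
  have e' : ∀ i, m * reflect v i = n * v i := fun i => congrFun e i
  by_cases h0 : v 0 = 0
  · have e1 : m * v 1 = n * v 1 := by simpa [reflect, h0] using e' 1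
    have e2 : m * (v 2 + v 3) = n * v 2 := by simpa [reflect, h0] using e' 2
    have e3 : m * -v 3 = n * v 3 := by simpa [reflect, h0] using e' 3
    have h3 : v 3 = 0 := by
      by_contra h3
      obtain rfl : n = -m := by
        apply mul_right_cancel₀ h3
        linear_combination -e3
      have h1 : v 1 = 0 := by
        have : 2 * m ≠ 0 := mul_ne_zero two_ne_zero hm
        apply mul_left_cancel₀ this
        linear_combination e1
      have h32 : v 3 = -2 * v 2 := by
        apply mul_left_cancel₀ hm
        linear_combination e2
      have h2 : v 2 ^ 4 = 0 := by
        simp only [quarticSec33, h0, h1, h32] at hF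
        linarith
      rw [pow_eq_zero_iff (by norm_num)] at h2
      exact h3 (by rw [h32, h2, mul_zero])
    have hp : (v 2 - v 1) *
        (v 2 ^ 3 + 5 * v 1 * v 2 ^ 2 - 30 * v 1 ^ 2 * v 2 - 18 * v 1 ^ 3) = 0 := by
      simp only [quarticSec33, h0, h3] at hF
      linarith
    have h21 : v 2 = v 1 := by
      rcases mul_eq_zero.1 hp with h | h
      · exact sub_eq_zero.1 h
      · obtain ⟨h1, h2⟩ := eq_zero_of_cubic h
        rw [h1, h2]
    have h1 : v 1 ≠ 0 := by
      intro h1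
      refine hv (funext fun i => ?_)
      fin_cases i
      exacts [h0, h1, h21.trans h1, h3]
    refine Quotient.sound ⟨1, v 1, one_ne_zero, h1, funext fun i => ?_⟩
    fin_cases i <;> simp [baseSolution, h0, h21, h3]
  · exfalso
    have e0 : m * -v 0 = n * v 0 := by simpa [reflect, h0] using e' 0
    obtain rfl : n = -m := by
      apply mul_right_cancel₀ h0
      linear_combination -e0
    have hz : ∀ x : ℤ, m * x = -m * x → x = 0 := by
      intro x hx
      have : 2 * m ≠ 0 := mul_ne_zero two_ne_zero hm
      apply mul_left_cancel₀ this
      linear_combination hx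
    have h1 : v 1 = 0 := hz _ (by simpa [reflect, h0] using e' 1)
    have h2 : v 2 = 0 := hz _ (by simpa [reflect, h0] using e' 2)
    have h3 : v 3 = 0 := hz _ (by simpa [reflect, h0] using e' 3)
    simp [quarticSec33, h1, h2, h3, h0] at hF

theorem card_modEq_card_fixed {α : Type*} [Fintype α] {f : α → α} (hf : Function.Involutive f) :
    Nat.card α ≡ Nat.card (Function.fixedPoints f) [MOD 2] := by
  classical
  rw [Nat.card_eq_fintype_card, Nat.card_eq_fintype_card]
  exact Equiv.Perm.card_fixedPoints_modEq (f := (f : Function.End α)) (p := 2) (n := 1)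
    (funext fun x => hf x)

theorem infinite_rationalPoint : Infinite RationalPoint := by
  by_contra hfin
  rw [not_infinite_iff_finite] at hfin
  have := Fintype.ofFinite RationalPoint
  have h0 : Function.fixedPoints pointResidual = ∅ :=
    Set.eq_empty_of_forall_notMem pointResidual_ne
  have h1 : Function.fixedPoints pointReflect = {⟦baseSolution⟧} :=
    Set.eq_singleton_iff_unique_mem.2 ⟨pointReflect_base, fun _ => eq_base_of_pointReflect⟩
  have c0 := card_modEq_card_fixed pointResidual_involutive
  have c1 := card_modEq_card_fixed pointReflect_involutive
  have h01 := c0.symm.trans c1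
  rw [h0, h1] at h01
  simp [Nat.ModEq] at h01

/-- The quartic equation of Section 3.3 has infinitely many pairwise
non-proportional nonzero integer solutions. -/
theorem stmt_14 : ∃ S : Set (Fin 4 → ℤ), S.Infinite
    ∧ (∀ v ∈ S, v ≠ 0 ∧ quarticSec33 v = 0)
    ∧ (∀ v ∈ S, ∀ w ∈ S, v ≠ w → ¬ Proportional v w) := by
  have := infinite_rationalPoint
  have hout : ∀ q q' : RationalPoint, Proportional q.out.1 q'.out.1 → q = q' := fun q q' h =>
    Quotient.out_equiv_out.1 (equiv_of_proportional h)
  refine ⟨Set.range fun q : RationalPoint => q.out.1, Set.infinite_range_of_injective ?_, ?_, ?_⟩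
  · intro q q' h
    refine hout q q' ⟨1, funext fun i => ?_⟩
    have hi : q.out.1 i = q'.out.1 i := congrFun h i
    rw [hi, one_mul]
  · rintro _ ⟨q, rfl⟩
    exact q.out.2
  · rintro _ ⟨q, rfl⟩ _ ⟨q', rfl⟩ hne h
    exact hne (by rw [hout q q' h])
end

section
/- Let h, X, Y be rational numbers satisfying Y² = 4(h+1)²X⁴ + 8h(h−2)X³ + 4X² − 4h(h+2)X + (h−1)², and define x₁ = 4hX³−2X²+2XY+6hX+2h−1, x₂ = 4X³+2hX²+2hX+2X−Y−h, x₃ = −4hX³+10X²−2XY+2hX+2h−1, x₄ = 4X³+6hX²+2hX−4X+Y+h. Then x₁²+2x₂² = x₃²+2x₄², and (x₁,x₂,x₃,x₄) satisfies the degree-10 equation (x₁²+2x₂²)⁴(x₁²+x₂²) + (x₁²+2x₂²)³(x₃²+2x₄²)(2x₁²+3x₂²) − (x₃²+2x₄²)⁵ + (x₁²+2x₂²)³(x₁⁴+4x₁²x₂²+4x₂⁴−4x₂²x₃²−8x₂²x₄²−x₃⁴−4x₃²x₄²−4x₄⁴ + 2hx₂(x₁²x₃−2x₁²x₄+2x₂²x₃−4x₂²x₄+x₃³+2x₃x₄²))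 = 0. -/
/-- The parametric solution of Section 5: rational points `(X, Y)` on the
quartic elliptic curve `Y² = 4(h+1)²X⁴ + 8h(h−2)X³ + 4X² − 4h(h+2)X + (h−1)²`
give points on the degree-10 surface (66) lying on the quadric
`x₁² + 2x₂² = x₃² + 2x₄²`. -/
theorem stmt_18 (h X Y : ℚ)
    (hXY : Y ^ 2 = 4 * (h + 1) ^ 2 * X ^ 4 + 8 * h * (h - 2) * X ^ 3
      + 4 * X ^ 2 - 4 * h * (h + 2) * X + (h - 1) ^ 2) :
    let x₁ := 4 * h * X ^ 3 - 2 * X ^ 2 + 2 * X * Y + 6 * h * X + 2 * h - 1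
    let x₂ := 4 * X ^ 3 + 2 * h * X ^ 2 + 2 * h * X + 2 * X - Y - h
    let x₃ := -4 * h * X ^ 3 + 10 * X ^ 2 - 2 * X * Y + 2 * h * X + 2 * h - 1
    let x₄ := 4 * X ^ 3 + 6 * h * X ^ 2 + 2 * h * X - 4 * X + Y + h
    x₁ ^ 2 + 2 * x₂ ^ 2 = x₃ ^ 2 + 2 * x₄ ^ 2
    ∧ (x₁ ^ 2 + 2 * x₂ ^ 2) ^ 4 * (x₁ ^ 2 + x₂ ^ 2)
      + (x₁ ^ 2 + 2 * x₂ ^ 2) ^ 3 * (x₃ ^ 2 + 2 * x₄ ^ 2) * (2 * x₁ ^ 2 + 3 * x₂ ^ 2)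
      - (x₃ ^ 2 + 2 * x₄ ^ 2) ^ 5
      + (x₁ ^ 2 + 2 * x₂ ^ 2) ^ 3 *
        (x₁ ^ 4 + 4 * x₁ ^ 2 * x₂ ^ 2 + 4 * x₂ ^ 4 - 4 * x₂ ^ 2 * x₃ ^ 2
          - 8 * x₂ ^ 2 * x₄ ^ 2 - x₃ ^ 4 - 4 * x₃ ^ 2 * x₄ ^ 2 - 4 * x₄ ^ 4
          + 2 * h * x₂ * (x₁ ^ 2 * x₃ - 2 * x₁ ^ 2 * x₄ + 2 * x₂ ^ 2 * x₃
            - 4 * x₂ ^ 2 * x₄ + x₃ ^ 3 + 2 * x₃ * x₄ ^ 2)) = 0 := by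
  intro x₁ x₂ x₃ x₄
  have quadric : x₁ ^ 2 + 2 * x₂ ^ 2 = x₃ ^ 2 + 2 * x₄ ^ 2 := by
    ring
  have residual : x₁ ^ 2 - x₂ ^ 2 + 2 * h * x₂ * (x₃ - x₄) = 0 := by
    linear_combination (4 * X ^ 2 - 1 + 2 * h * (2 * X + 1)) * hXY
  refine ⟨quadric, ?_⟩
  clear_value x₁ x₂ x₃ x₄
  have hx₃ : x₃ ^ 2 = x₁ ^ 2 + 2 * x₂ ^ 2 - 2 * x₄ ^ 2 := by
    linear_combination -quadric
  have hx₃_cube : x₃ ^ 3 = (x₁ ^ 2 + 2 * x₂ ^ 2 - 2 * x₄ ^ 2) * x₃ := by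
    linear_combination x₃ * hx₃
  have hx₃_four : x₃ ^ 4 = (x₁ ^ 2 + 2 * x₂ ^ 2 - 2 * x₄ ^ 2) ^ 2 := by
    rw [← hx₃]
    ring
  rw [hx₃_four, hx₃_cube, hx₃]
  linear_combination 2 * (x₁ ^ 2 + 2 * x₂ ^ 2) ^ 4 * residual
end

section
/- For every positive integer n there exist infinitely many integers h such that the homogeneous quartic diophantine equation x₁⁴−11x₁²x₂²+x₂⁴+x₃⁴+6x₃³x₄+7x₃²x₄²−6x₃x₄³+x₄⁴ + h(4x₁²x₂x₃−2x₁²x₂x₄+x₁²x₃²−3x₁²x₃x₄+2x₁²x₄²+2x₂³x₃+8x₂³x₄+3x₂²x₃²+6x₂²x₃x₄−15x₂²x₄²−x₂x₃³−4x₂x₃²x₄−2x₂x₃x₄²+x₂x₄³) = 0 has at least n pairwise non-proportional integer solutions. -/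
/-- The quartic form of Section 3.2 of the paper, with parameter `h`. -/
def quarticH (h : ℤ) (v : Fin 4 → ℤ) : ℤ :=
  v 0 ^ 4 - 11 * v 0 ^ 2 * v 1 ^ 2 + v 1 ^ 4 + v 2 ^ 4 + 6 * v 2 ^ 3 * v 3
    + 7 * v 2 ^ 2 * v 3 ^ 2 - 6 * v 2 * v 3 ^ 3 + v 3 ^ 4
    + h * (4 * v 0 ^ 2 * v 1 * v 2 - 2 * v 0 ^ 2 * v 1 * v 3
      + v 0 ^ 2 * v 2 ^ 2 - 3 * v 0 ^ 2 * v 2 * v 3 + 2 * v 0 ^ 2 * v 3 ^ 2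
      + 2 * v 1 ^ 3 * v 2 + 8 * v 1 ^ 3 * v 3 + 3 * v 1 ^ 2 * v 2 ^ 2
      + 6 * v 1 ^ 2 * v 2 * v 3 - 15 * v 1 ^ 2 * v 3 ^ 2
      - v 1 * v 2 ^ 3 - 4 * v 1 * v 2 ^ 2 * v 3 - 2 * v 1 * v 2 * v 3 ^ 2
      + v 1 * v 3 ^ 3)

namespace QuarticH

/-- A point `(c, d, x, s)` of projective three-space over `R`. -/
structure Point (R : Type*) where
  /-- the third (and first free) coordinate of the quartic -/
  c : R
  /-- the fourth coordinate of the quartic -/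
  d : R
  /-- the common value of the first two coordinates of the quartic -/
  x : R
  /-- the auxiliary coordinate splitting the quartic into two quadrics -/
  s : R

namespace Point

variable {R S : Type*} [CommRing R] [CommRing S]

/-- The image of a point under a ring homomorphism. -/
def map (f : R →+* S) (v : Point R) : Point S :=
  ⟨f v.c, f v.d, f v.x, f v.s⟩

/-- Rescaling of homogeneous coordinates. -/
def scale (k : R) (v : Point R) : Point R :=
  ⟨k * v.c, k * v.d, k * v.x, k * v.s⟩

/-- The point `(1, 1, 1, 0)`, which lies on all the curves considered here. -/
def base : Point R :=
  ⟨1, 1, 1, 0⟩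

end Point

open Point

section Curve

variable {R S : Type*} [CommRing R] [CommRing S]

/-- The first quadric. -/
def quadA (h : R) (v : Point R) : R :=
  v.c ^ 2 + 3 * v.c * v.d - v.d ^ 2 - 3 * v.x ^ 2 - h * v.s * v.x

/-- The second quadric. -/
def quadB (h : R) (v : Point R) : R :=
  6 * v.x * v.s + h * v.s ^ 2 - h * (v.c + v.d) * v.s + 3 * v.x * (v.c + v.d)
    + 4 * v.c ^ 2 + 3 * v.c * v.d - 13 * v.d ^ 2

/-- The polar form of `quadA`. -/
def polarA (h : R) (u v : Point R) : R :=
  2 * u.c * v.c + 3 * (u.c * v.d + u.d * v.c) - 2 * u.d * v.d - 6 * u.x * v.x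
    - h * (u.s * v.x + u.x * v.s)

/-- The polar form of `quadB`. -/
def polarB (h : R) (u v : Point R) : R :=
  6 * (u.x * v.s + u.s * v.x) + 2 * h * u.s * v.s
    - h * ((u.c + u.d) * v.s + (v.c + v.d) * u.s)
    + 3 * (u.x * (v.c + v.d) + v.x * (u.c + u.d))
    + 8 * u.c * v.c + 3 * (u.c * v.d + u.d * v.c) - 26 * u.d * v.d

/-- The intersection of the two quadrics, a curve of genus one for general `h`. -/
def OnCurve (h : R) (v : Point R) : Prop :=
  quadA h v = 0 ∧ quadB h v = 0

/-- The point where the tangent line to the curve at `v` meets the plane `x = 0`. -/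
def tangent (h : R) (v : Point R) : Point R :=
  let ac := 2 * v.c + 3 * v.d
  let ad := 3 * v.c - 2 * v.d
  let as := -(h * v.x)
  let bc := -(h * v.s) + 3 * v.x + 8 * v.c + 3 * v.d
  let bd := -(h * v.s) + 3 * v.x + 3 * v.c - 26 * v.d
  let bs := 6 * v.x + 2 * h * v.s - h * (v.c + v.d)
  ⟨ad * bs - as * bd, as * bc - ac * bs, 0, ac * bd - ad * bc⟩

/-- First coordinate of the vector orthogonal to the restrictions of both quadrics to the plane
spanned by the tangent line at `v` and the base point. -/
def weight₀ (h : R) (v : Point R) : R :=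
  polarA h v base * polarB h (tangent h v) base - polarA h (tangent h v) base * polarB h v base

/-- Second coordinate of the vector orthogonal to the restrictions of both quadrics to the plane
spanned by the tangent line at `v` and the base point. -/
def weight₁ (h : R) (v : Point R) : R :=
  polarA h (tangent h v) base * quadB h (tangent h v)
    - quadA h (tangent h v) * polarB h (tangent h v) base

/-- Third coordinate of the vector orthogonal to the restrictions of both quadrics to the plane
spanned by the tangent line at `v` and the base point. -/
def weight₂ (h : R) (v : Point R) : R :=
  quadA h (tangent h v) * polarB h v base - polarA h v base * quadB h (tangent h v)

/-- The combination `a v + b t + e p` of the point `v`, its tangent point `t` and the base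
point `p`. -/
def combine (a b e : R) (v t : Point R) : Point R :=
  ⟨a * v.c + b * t.c + e, a * v.d + b * t.d + e, a * v.x + b * t.x + e, a * v.s + b * t.s⟩

/-- The residual intersection of the curve with the plane through the base point and the tangent
line at `v`. -/
def step (h : R) (v : Point R) : Point R :=
  combine (weight₀ h v * weight₁ h v) (weight₀ h v * weight₂ h v) (weight₂ h v ^ 2)
    v (tangent h v)

theorem polarA_tangent (h : R) (v : Point R) : polarA h v (tangent h v) = 0 := by
  simp only [polarA, tangent]
  ring

theorem polarB_tangent (h : R) (v : Point R) : polarB h v (tangent h v) = 0 := by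
  simp only [polarB, tangent]
  ring

theorem quadA_combine (h a b e : R) (v t : Point R) :
    quadA h (combine a b e v t) = a ^ 2 * quadA h v + b ^ 2 * quadA h t
      + a * b * polarA h v t + a * e * polarA h v base + b * e * polarA h t base := by
  simp only [quadA, polarA, combine, base]
  ring

theorem quadB_combine (h a b e : R) (v t : Point R) :
    quadB h (combine a b e v t) = a ^ 2 * quadB h v + b ^ 2 * quadB h t
      + a * b * polarB h v t + a * e * polarB h v base + b * e * polarB h t base := by
  simp only [quadB, polarB, combine, base]
  ring

theorem OnCurve.step {h : R} {v : Point R} (hv : OnCurve h v) : OnCurve h (step h v) := by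
  constructor
  · rw [QuarticH.step, quadA_combine, hv.1, polarA_tangent]
    simp only [weight₀, weight₁, weight₂]
    ring
  · rw [QuarticH.step, quadB_combine, hv.2, polarB_tangent]
    simp only [weight₀, weight₁, weight₂]
    ring

/-- An explicit point of the curve, namely the residual intersection of the curve with its
osculating plane at the base point. -/
def seed (h : R) : Point R :=
  ⟨2030109417 * h ^ 12 - 458685190683 * h ^ 11 + 5374880733775 * h ^ 10
      + 26026693723926 * h ^ 9 - 79272926495982 * h ^ 8 + 180521409785832 * h ^ 7
      - 379287280600884 * h ^ 6 + 593365204267704 * h ^ 5 - 715092069345696 * h ^ 4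
      + 761052715430904 * h ^ 3 - 651168842154480 * h ^ 2 + 354887022965904 * h
      - 90342351058752,
    -21737983995 * h ^ 12 + 314716939443 * h ^ 11 + 3443689464301 * h ^ 10
      - 21382257531006 * h ^ 9 + 74600379248886 * h ^ 8 - 145178659591884 * h ^ 7
      + 267716174400036 * h ^ 6 - 355453814179008 * h ^ 5 + 373679255923848 * h ^ 4
      - 309350251615392 * h ^ 3 + 219478079242656 * h ^ 2 - 103587331807440 * h
      + 26956991848176,
    -50966096139 * h ^ 12 + 1828311441915 * h ^ 11 - 18219621470367 * h ^ 10
      + 42204495625356 * h ^ 9 - 106633909550700 * h ^ 8 + 192297272151276 * h ^ 7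
      - 267302577712896 * h ^ 6 + 321687293916564 * h ^ 5 - 316527707796408 * h ^ 4
      + 233920813214088 * h ^ 3 - 102303597099600 * h ^ 2 + 17242760551536 * h
      + 6557106125232,
    164686714596 * h ^ 11 - 5918492161494 * h ^ 10 + 44304261673158 * h ^ 9
      - 148605447827772 * h ^ 8 + 402518385844848 * h ^ 7 - 929278025151264 * h ^ 6
      + 1564692660721116 * h ^ 5 - 2179547238187872 * h ^ 4 + 2455942426663752 * h ^ 3
      - 2179366475656968 * h ^ 2 + 1244393029099584 * h - 372297914443728⟩

theorem onCurve_seed (h : R) : OnCurve h (seed h) := by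
  constructor
  · simp only [quadA, seed]
    ring
  · simp only [quadB, seed]
    ring

/-- The sequence of points obtained by iterating `step` from `seed`. -/
def orbit (h : R) : ℕ → Point R
  | 0 => seed h
  | k + 1 => step h (orbit h k)

theorem onCurve_orbit (h : R) (k : ℕ) : OnCurve h (orbit h k) := by
  induction k with
  | zero => exact onCurve_seed h
  | succ k ih => exact ih.step

theorem map_seed (f : R →+* S) (h : R) : (seed h).map f = seed (f h) := by
  simp [Point.map, seed, map_ofNat]

theorem map_step (f : R →+* S) (h : R) (v : Point R) :
    (step h v).map f = step (f h) (v.map f) := by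
  simp [Point.map, step, combine, weight₀, weight₁, weight₂, quadA, quadB, polarA, polarB,
    tangent, base, map_ofNat]

theorem map_orbit (f : R →+* S) (h : R) (k : ℕ) : (orbit h k).map f = orbit (f h) k := by
  induction k with
  | zero => exact map_seed f h
  | succ k ih => rw [orbit, map_step, ih, orbit]

/-- The norm form `(m + n ω) (m + n ω')`, where `ω`, `ω'` are the roots of `ω² = 3 ω + 1`. -/
def normForm (m n : R) : R :=
  m ^ 2 + 3 * m * n - n ^ 2

/-- The `1`-coordinate of `(1 + ω) (m + n ω)²`. -/
def formC (m n : R) : R :=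
  m ^ 2 + 2 * m * n + 4 * n ^ 2

/-- The `ω`-coordinate of `(1 + ω) (m + n ω)²`. -/
def formD (m n : R) : R :=
  m ^ 2 + 8 * m * n + 13 * n ^ 2

/-- Parametrization of the nodal rational curve obtained for `h = 0`. -/
def param (m n : R) : Point R :=
  ⟨6 * normForm m n * formC m n, 6 * normForm m n * formD m n, 6 * normForm m n ^ 2,
    -(3 * normForm m n * (formC m n + formD m n) + 4 * formC m n ^ 2
      + 3 * formC m n * formD m n - 13 * formD m n ^ 2)⟩

theorem tangent_param (k m n : R) :
    tangent 0 (scale k (param m n)) =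
      ⟨k ^ 2 * normForm m n ^ 3 * (216 * m ^ 2 - 2160 * m * n - 3024 * n ^ 2),
        -(k ^ 2 * normForm m n ^ 3 * (1080 * m ^ 2 + 6048 * m * n + 10152 * n ^ 2)), 0,
        -(k ^ 2 * normForm m n ^ 2 * (4104 * m ^ 4 + 51624 * m ^ 3 * n + 265356 * m ^ 2 * n ^ 2
          + 609012 * m * n ^ 3 + 522396 * n ^ 4))⟩ := by
  simp only [tangent, scale, param, normForm, formC, formD, Point.mk.injEq]
  refine ⟨?_, ?_, trivial, ?_⟩ <;> ring

theorem weight₀_param (k m n : R) :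
    weight₀ 0 (scale k (param m n)) =
      -(5913648 * k ^ 3 * normForm m n ^ 3 * n ^ 4 * (7 * m ^ 2 + 44 * m * n + 73 * n ^ 2)) := by
  rw [weight₀, tangent_param]
  simp only [polarA, polarB, scale, param, base, normForm, formC, formD]
  ring

theorem weight₁_param (k m n : R) :
    weight₁ 0 (scale k (param m n)) =
      45984526848 * k ^ 6 * normForm m n ^ 9 * n ^ 2 * (7 * m ^ 4 + 88 * m ^ 3 * n
        + 438 * m ^ 2 * n ^ 2 + 964 * m * n ^ 3 + 796 * n ^ 4) := by
  rw [weight₁, tangent_param]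
  simp only [polarA, polarB, quadA, quadB, base, normForm]
  ring

theorem weight₂_param (k m n : R) :
    weight₂ 0 (scale k (param m n)) =
      1277347968 * k ^ 5 * normForm m n ^ 7 * n ^ 3 * (7 * m ^ 3 + 66 * m ^ 2 * n
        + 219 * m * n ^ 2 + 241 * n ^ 3) := by
  rw [weight₂, tangent_param]
  simp only [polarA, polarB, quadA, quadB, scale, param, base, normForm, formC, formD]
  ring

/-- The `1`-coordinate of `(-22 + 7 ω) (m + n ω')²`. -/
def nextM (m n : R) : R :=
  -22 * m ^ 2 - 146 * m * n - 241 * n ^ 2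

/-- The `ω`-coordinate of `(-22 + 7 ω) (m + n ω')²`. -/
def nextN (m n : R) : R :=
  7 * m ^ 2 + 44 * m * n + 73 * n ^ 2

theorem step_param (k m n : R) :
    step 0 (scale k (param m n)) =
      scale (-(10071715008356352 * k ^ 10 * normForm m n ^ 12 * n ^ 8))
        (param (nextM m n) (nextN m n)) := by
  rw [step, weight₀_param, weight₁_param, weight₂_param, tangent_param]
  simp only [combine, scale, param, nextM, nextN, normForm, formC, formD, Point.mk.injEq]
  refine ⟨?_, ?_, ?_, ?_⟩ <;> ring

theorem seed_zero : seed (0 : R) = scale 1499109768 (param (-22) 7) := by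
  simp only [seed, scale, param, normForm, formC, formD, Point.mk.injEq]
  refine ⟨?_, ?_, ?_, ?_⟩ <;> ring

end Curve

section Real

/-- The larger root of `ω² = 3 ω + 1`. -/
noncomputable def root₁ : ℝ :=
  (3 + √13) / 2

/-- The smaller root of `ω² = 3 ω + 1`. -/
noncomputable def root₂ : ℝ :=
  (3 - √13) / 2

theorem root_add : root₁ + root₂ = 3 := by
  rw [root₁, root₂]
  ring

theorem root_mul : root₁ * root₂ = -1 := by
  have h : √13 ^ 2 = (13 : ℝ) := Real.sq_sqrt (by norm_num)
  rw [root₁, root₂]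
  linear_combination -h / 4

theorem root₁_sq : root₁ ^ 2 = 3 * root₁ + 1 := by
  linear_combination root₁ * root_add - root_mul

theorem root₂_sq : root₂ ^ 2 = 3 * root₂ + 1 := by
  linear_combination root₂ * root_add - root_mul

theorem root₁_sub_root₂_ne_zero : root₁ - root₂ ≠ 0 := by
  intro h
  have : (root₁ - root₂) ^ 2 = 13 := by
    linear_combination (root₁ + root₂ + 3) * root_add - 4 * root_mul
  rw [h] at this
  norm_num at this

theorem normForm_eq_mul (m n : ℝ) :
    normForm m n = (m + n * root₁) * (m + n * root₂) := by
  rw [normForm]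
  linear_combination -(m * n) * root_add - n ^ 2 * root_mul

theorem seed_norm : (-22 + 7 * root₁) * (-22 + 7 * root₂) = -27 := by
  linear_combination -154 * root_add + 49 * root_mul

theorem seed_left_ne_zero : -22 + 7 * root₁ ≠ 0 := by
  intro h
  have := seed_norm
  rw [h] at this
  norm_num at this

theorem seed_right_ne_zero : -22 + 7 * root₂ ≠ 0 := by
  intro h
  have := seed_norm
  rw [h] at this
  norm_num at this

/-- The multiplier of the nodal curve obtained for `h = 0`. -/
noncomputable def ratio : ℝ :=
  (-22 + 7 * root₁) / (-22 + 7 * root₂)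

theorem ratio_ne_zero : ratio ≠ 0 :=
  div_ne_zero seed_left_ne_zero seed_right_ne_zero

theorem abs_ratio_ne_one : |ratio| ≠ 1 := by
  intro h
  rcases (abs_eq zero_le_one).1 h with h | h
  · rw [ratio, div_eq_iff seed_right_ne_zero] at h
    exact root₁_sub_root₂_ne_zero (by linear_combination h / 7)
  · rw [ratio, div_eq_iff seed_right_ne_zero] at h
    have h' : (-23 : ℝ) = 0 := by linear_combination h - 7 * root_add
    norm_num at h'

theorem ratio_zpow_injective : Function.Injective fun a : ℤ => ratio ^ a := by
  intro a b hab
  refine zpow_right_injective₀ (abs_pos.2 ratio_ne_zero) abs_ratio_ne_one ?_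
  simpa only [abs_zpow] using congrArg abs hab

/-- The exponents `1, -1, 3, -5, 11, …` of the points of the orbit for `h = 0`. -/
def index : ℕ → ℤ
  | 0 => 1
  | k + 1 => 1 - 2 * index k

theorem three_mul_index (k : ℕ) : 3 * index k = 1 + 2 * (-2) ^ k := by
  induction k with
  | zero => rfl
  | succ k ih =>
    rw [index, pow_succ]
    linear_combination -2 * ih

theorem index_injective : Function.Injective index := by
  intro k l hkl
  have h : (-2 : ℤ) ^ k = (-2) ^ l := by
    have hk := three_mul_index k
    rw [hkl, three_mul_index l] at hk
    linarith
  have h' := congrArg Int.natAbs h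
  simp only [Int.natAbs_pow] at h'
  exact Nat.pow_right_injective le_rfl h'

theorem index_ne_zero (k : ℕ) : index k ≠ 0 := by
  cases k with
  | zero => exact one_ne_zero
  | succ k =>
    rw [index]
    omega

theorem next_left (m n : ℝ) :
    nextM m n + nextN m n * root₁ = (-22 + 7 * root₁) * (m + n * root₂) ^ 2 := by
  have h : root₂ = 3 - root₁ := by linear_combination root_add
  rw [nextM, nextN, h]
  linear_combination (14 * m * n + 43 * n ^ 2 - 7 * n ^ 2 * root₁) * root₁_sq

theorem next_right (m n : ℝ) :
    nextM m n + nextN m n * root₂ = (-22 + 7 * root₂) * (m + n * root₁) ^ 2 := by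
  have h : root₁ = 3 - root₂ := by linear_combination root_add
  rw [nextM, nextN, h]
  linear_combination (14 * m * n + 43 * n ^ 2 - 7 * n ^ 2 * root₂) * root₂_sq

theorem form_eq_mul (m n : ℝ) :
    formC m n + formD m n * root₁ = (1 + root₁) * (m + n * root₁) ^ 2 := by
  rw [formC, formD]
  linear_combination -(2 * m * n + 4 * n ^ 2 + n ^ 2 * root₁) * root₁_sq

/-- For `h = 0` the points of the orbit are given by nondegenerate parameters whose quotients
are powers of `ratio`. -/
theorem exists_orbit_zero (k : ℕ) : ∃ r m n : ℤ, r ≠ 0 ∧ orbit 0 k = scale r (param m n) ∧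
    (m + n * root₂ : ℝ) ≠ 0 ∧ (m + n * root₁ : ℝ) = ratio ^ index k * (m + n * root₂) := by
  induction k with
  | zero =>
    refine ⟨1499109768, -22, 7, by norm_num, seed_zero, ?_, ?_⟩
    · exact_mod_cast seed_right_ne_zero
    · push_cast
      rw [index, zpow_one, ratio, div_mul_cancel₀ _ seed_right_ne_zero]
  | succ k ih =>
    obtain ⟨r, m, n, hr, ho, h₂, h₁⟩ := ih
    have h₁' : (m + n * root₁ : ℝ) ≠ 0 :=
      h₁ ▸ mul_ne_zero (zpow_ne_zero _ ratio_ne_zero) h₂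
    have hN : normForm m n ≠ 0 := by
      have h : normForm (m : ℝ) n ≠ 0 := normForm_eq_mul m n ▸ mul_ne_zero h₁' h₂
      rw [normForm] at h ⊢
      exact_mod_cast h
    have hn : n ≠ 0 := by
      rintro rfl
      simp only [Int.cast_zero, zero_mul, add_zero] at h₁ h₂
      have h : ratio ^ index k = ratio ^ (0 : ℤ) := by
        rw [zpow_zero]
        exact (mul_eq_right₀ h₂).1 h₁.symm
      exact index_ne_zero k (ratio_zpow_injective h)
    have cast_M : ((nextM m n : ℤ) : ℝ) = nextM (m : ℝ) n := by
      simp only [nextM]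
      push_cast
      ring
    have cast_N : ((nextN m n : ℤ) : ℝ) = nextN (m : ℝ) n := by
      simp only [nextN]
      push_cast
      ring
    refine ⟨-(10071715008356352 * r ^ 10 * normForm m n ^ 12 * n ^ 8), nextM m n, nextN m n,
      ?_, ?_, ?_, ?_⟩
    · exact neg_ne_zero.2 (mul_ne_zero (mul_ne_zero (mul_ne_zero (by norm_num)
        (pow_ne_zero _ hr)) (pow_ne_zero _ hN)) (pow_ne_zero _ hn))
    · rw [orbit, ho, step_param]
    · rw [cast_M, cast_N, next_right]
      exact mul_ne_zero seed_right_ne_zero (pow_ne_zero _ h₁')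
    · have hz : ratio ^ index k ≠ 0 := zpow_ne_zero _ ratio_ne_zero
      rw [cast_M, cast_N, next_left, next_right, h₁, index, zpow_sub₀ ratio_ne_zero, zpow_one,
        mul_comm 2, zpow_mul, zpow_ofNat]
      field_simp
      rw [ratio, div_mul_cancel₀ _ seed_right_ne_zero]

end Real

/-- The first three coordinates of two points are proportional, in the sense that the minors
involving the coordinate `x` vanish. -/
def SameAffine {R : Type*} [CommRing R] (v w : Point R) : Prop :=
  v.c * w.x = w.c * v.x ∧ v.d * w.x = w.d * v.x

theorem not_sameAffine_orbit_zero {k l : ℕ} (hkl : k ≠ l) :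
    ¬ SameAffine (orbit (0 : ℤ) k) (orbit 0 l) := by
  obtain ⟨r, m, n, hr, ho, h₂, h₁⟩ := exists_orbit_zero k
  obtain ⟨r', m', n', hr', ho', h₂', h₁'⟩ := exists_orbit_zero l
  have hN : ((normForm m n : ℤ) : ℝ) = (m + n * root₁) * (m + n * root₂) := by
    rw [← normForm_eq_mul, normForm, normForm]
    push_cast
    ring
  have hN' : ((normForm m' n' : ℤ) : ℝ) = (m' + n' * root₁) * (m' + n' * root₂) := by
    rw [← normForm_eq_mul, normForm, normForm]
    push_cast
    ring
  have h₃ : (m + n * root₁ : ℝ) ≠ 0 := h₁ ▸ mul_ne_zero (zpow_ne_zero _ ratio_ne_zero) h₂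
  have h₃' : (m' + n' * root₁ : ℝ) ≠ 0 := h₁' ▸ mul_ne_zero (zpow_ne_zero _ ratio_ne_zero) h₂'
  have hne : normForm m n ≠ 0 := by
    exact_mod_cast hN ▸ mul_ne_zero h₃ h₂
  have hne' : normForm m' n' ≠ 0 := by
    exact_mod_cast hN' ▸ mul_ne_zero h₃' h₂'
  rintro ⟨hc, hd⟩
  rw [ho, ho'] at hc hd
  simp only [scale, param] at hc hd
  have hs : 36 * r * r' * normForm m n * normForm m' n' ≠ 0 :=
    mul_ne_zero (mul_ne_zero (mul_ne_zero (mul_ne_zero (by norm_num) hr) hr') hne) hne'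
  have hC : formC m n * normForm m' n' = formC m' n' * normForm m n :=
    mul_left_cancel₀ hs (by linear_combination hc)
  have hD : formD m n * normForm m' n' = formD m' n' * normForm m n :=
    mul_left_cancel₀ hs (by linear_combination hd)
  have hC' := congrArg (Int.cast : ℤ → ℝ) hC
  have hD' := congrArg (Int.cast : ℤ → ℝ) hD
  have hF := form_eq_mul m n
  have hF' := form_eq_mul m' n'
  simp only [formC, formD] at hC' hD' hF hF'
  push_cast [hN, hN'] at hC' hD'
  have hroot : 1 + root₁ ≠ 0 := by
    intro h
    have : (3 : ℝ) = 0 := by linear_combination (4 - root₁) * h + root₁_sq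
    norm_num at this
  have key : (m + n * root₁ : ℝ) * (m' + n' * root₂) = (m' + n' * root₁) * (m + n * root₂) := by
    refine mul_left_cancel₀ (mul_ne_zero hroot (mul_ne_zero h₃ h₃')) ?_
    linear_combination hC' + root₁ * hD'
      - (m' + n' * root₁) * (m' + n' * root₂) * hF + (m + n * root₁) * (m + n * root₂) * hF'
  rw [h₁, h₁'] at key
  have hz : ratio ^ index k = ratio ^ index l :=
    mul_right_cancel₀ (mul_ne_zero h₂ h₂') (by linear_combination key)
  exact hkl (index_injective (ratio_zpow_injective hz))

open Polynomial in
theorem eventually_eval_ne_zero {P : ℤ[X]} {a : ℤ} (ha : P.eval a ≠ 0) :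
    ∀ᶠ h : ℤ in Filter.cofinite, P.eval h ≠ 0 := by
  have hP : P ≠ 0 := by
    rintro rfl
    exact ha eval_zero
  rw [Filter.eventually_cofinite]
  simpa only [not_not, IsRoot.def] using finite_setOfPred_isRoot hP

open Polynomial in
theorem eventually_not_sameAffine {k l : ℕ} (hkl : k ≠ l) :
    ∀ᶠ h : ℤ in Filter.cofinite, ¬ SameAffine (orbit h k) (orbit h l) := by
  have hev (a : ℤ) (j : ℕ) : orbit a j = (orbit (X : ℤ[X]) j).map (evalRingHom a) := by
    rw [map_orbit, coe_evalRingHom, eval_X]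
  have h₀ := not_sameAffine_orbit_zero hkl
  rw [SameAffine, not_and_or] at h₀
  rcases h₀ with h₀ | h₀
  · rw [← sub_eq_zero, hev, hev] at h₀
    simp only [Point.map, coe_evalRingHom, ← eval_mul, ← eval_sub] at h₀
    filter_upwards [eventually_eval_ne_zero h₀] with h hh hs
    apply hh
    rw [eval_sub, eval_mul, eval_mul, sub_eq_zero]
    simpa [hev, Point.map] using hs.1
  · rw [← sub_eq_zero, hev, hev] at h₀
    simp only [Point.map, coe_evalRingHom, ← eval_mul, ← eval_sub] at h₀
    filter_upwards [eventually_eval_ne_zero h₀] with h hh hs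
    apply hh
    rw [eval_sub, eval_mul, eval_mul, sub_eq_zero]
    simpa [hev, Point.map] using hs.2

/-- The quadruple attached to a point. -/
def toQuadruple (v : Point ℤ) : Fin 4 → ℤ :=
  ![v.x, v.x, v.c, v.d]

theorem OnCurve.quarticH_eq_zero {h : ℤ} {v : Point ℤ} (hv : OnCurve h v) :
    quarticH h (toQuadruple v) = 0 := by
  obtain ⟨hA, hB⟩ := hv
  rw [quadA] at hA
  rw [quadB] at hB
  simp only [quarticH, toQuadruple, Matrix.cons_val]
  linear_combination (v.c ^ 2 + 3 * v.c * v.d - v.d ^ 2 + 3 * v.x ^ 2 + h * v.s * v.x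
    - h * v.x * (v.c + v.d)) * hA + h * v.x ^ 2 * hB

theorem sameAffine_of_proportional {v w : Point ℤ}
    (hvw : Proportional (toQuadruple v) (toQuadruple w)) : SameAffine v w := by
  obtain ⟨k, hk⟩ := hvw
  have hx := congrFun hk 0
  have hc := congrFun hk 2
  have hd := congrFun hk 3
  simp only [toQuadruple, Matrix.cons_val] at hx hc hd
  constructor
  · have : (v.c * w.x : ℚ) = w.c * v.x := by rw [hx, hc]; ring
    exact_mod_cast this
  · have : (v.d * w.x : ℚ) = w.d * v.x := by rw [hx, hd]; ring
    exact_mod_cast this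

theorem sameAffine_of_toQuadruple_eq_zero {v : Point ℤ} (w : Point ℤ)
    (hv : toQuadruple v = 0) : SameAffine v w := by
  have hx : v.x = 0 := congrFun hv 0
  have hc : v.c = 0 := congrFun hv 2
  have hd : v.d = 0 := congrFun hv 3
  simp [SameAffine, hx, hc, hd]

end QuarticH

open QuarticH in
/-- Main result of Section 3.2: for every `n` there are infinitely many
integers `h` such that the quartic equation with parameter `h` has at least
`n` pairwise non-proportional nonzero integer solutions. -/
theorem stmt_19 (n : ℕ) (hn : 0 < n) :
    {h : ℤ | ∃ S : Finset (Fin 4 → ℤ), S.card = n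
      ∧ (∀ v ∈ S, v ≠ 0 ∧ quarticH h v = 0)
      ∧ (∀ v ∈ S, ∀ w ∈ S, v ≠ w → ¬ Proportional v w)}.Infinite := by
  have hev : ∀ᶠ h : ℤ in Filter.cofinite, ∀ k ∈ Finset.range n, ∀ l ∈ Finset.range (n + 1),
      k ≠ l → ¬ SameAffine (orbit h k) (orbit h l) := by
    simp only [Filter.eventually_all_finset, Filter.eventually_imp_distrib_left]
    exact fun k _ l _ hkl => eventually_not_sameAffine hkl
  refine Filter.frequently_cofinite_iff_infinite.1 (hev.mono fun h hh => ?_).frequently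
  have hprop {k l : ℕ} (hk : k < n) (hl : l < n) (hkl : k ≠ l) :
      ¬ Proportional (toQuadruple (orbit h k)) (toQuadruple (orbit h l)) := fun hp =>
    hh k (Finset.mem_range.2 hk) l (Finset.mem_range.2 (by omega)) hkl
      (sameAffine_of_proportional hp)
  refine ⟨(Finset.range n).image fun k => toQuadruple (orbit h k), ?_, ?_, ?_⟩
  · rw [Finset.card_image_of_injOn, Finset.card_range]
    intro k hk l hl hkl
    by_contra hne
    refine hprop (by simpa using hk) (by simpa using hl) hne ⟨1, ?_⟩
    simp only [one_mul]
    simp only at hkl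
    rw [hkl]
  · intro v hv
    obtain ⟨k, hk, rfl⟩ := Finset.mem_image.1 hv
    exact ⟨fun h₀ => hh k hk (k + 1) (by simpa using hk) k.succ_ne_self.symm
      (sameAffine_of_toQuadruple_eq_zero _ h₀), (onCurve_orbit h k).quarticH_eq_zero⟩
  · intro v hv w hw hvw
    obtain ⟨k, hk, rfl⟩ := Finset.mem_image.1 hv
    obtain ⟨l, hl, rfl⟩ := Finset.mem_image.1 hw
    refine hprop (Finset.mem_range.1 hk) (Finset.mem_range.1 hl) ?_
    rintro rfl
    exact hvw rfl
end
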